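/- arXiv:1107.2843 — 2 statements merged into one kernel-verified Lean document; each statement's English description precedes it below -/
import Mathlib

section
/- Let F be a free group, and for w ∈ F let |w| denote the length of the reduced word representing w. Let g ≥ 1 and m ≥ 1, let C_1, …, C_{m-1}, C be nontrivial cyclically reduced elements of F, and set s = |C_1| + … + |C_{m-1}| + |C|. Suppose the standard non-orientable quadratic equation ( ∏_{i=1}^{g} x_i² ) · ( ∏_{j=1}^{m-1} z_j⁻¹ C_j z_j ) · C = 1 has a solution in F. Then there exist elements w_1,…,w_{m-1} ∈ F with |w_j| ≤ 12s⁴ for all j, and elements e_1,…,e_g ∈ F with |e_i| ≤ 12s⁴ for all i, such that ( ∏_{j=1}^{m-1} w_j⁻¹ C_j w_j ) · C = e_1²·e_2²·…·e_g². -/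
/-- An element of a free group is cyclically reduced if, in its reduced word,
the first letter is not the inverse of the last letter. -/
def CyclicallyReduced {α : Type*} [DecidableEq α] (w : FreeGroup α) : Prop :=
  ∀ x ∈ w.toWord.head?, ∀ y ∈ w.toWord.getLast?, x.1 = y.1 → x.2 = y.2


namespace QE
open FreeGroup (mk invRev mul_mk inv_mk one_eq_mk)

variable {α β : Type*}

/-- number of occurrences of a letter with either sign -/
def cnt [DecidableEq β] (b : β) (L : List (β × Bool)) : ℕ := (L.map Prod.fst).count b

section cnt
variable [DecidableEq β]
@[simp] lemma cnt_nil (b : β) : cnt b [] = 0 := by simp [cnt]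
@[simp] lemma cnt_append (b : β) (L M : List (β × Bool)) : cnt b (L ++ M) = cnt b L + cnt b M := by
  simp [cnt]
lemma cnt_cons (b : β) (p : β × Bool) (L : List (β × Bool)) :
    cnt b (p :: L) = cnt b L + (if p.1 = b then 1 else 0) := by
  simp [cnt, List.count_cons]
@[simp] lemma cnt_cons_self (b : β) (s : Bool) (L : List (β × Bool)) :
    cnt b ((b, s) :: L) = cnt b L + 1 := by
  simp [cnt]
@[simp] lemma cnt_invRev (b : β) (L : List (β × Bool)) : cnt b (invRev L) = cnt b L := by
  simp [cnt, invRev, List.map_reverse, Function.comp_def]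
lemma cnt_pos {b : β} {L : List (β × Bool)} : 0 < cnt b L ↔ ∃ s, (b, s) ∈ L := by
  simp [cnt, List.count_pos_iff]
lemma cnt_eq_add (b : β) (L : List (β × Bool)) :
    cnt b L = L.count (b, true) + L.count (b, false) := by
  induction L with
  | nil => simp
  | cons p L ih =>
    obtain ⟨c, s⟩ := p
    rw [cnt_cons, ih, List.count_cons, List.count_cons]
    cases s <;> by_cases h : c = b <;> simp [h] <;> omega
lemma cnt_flatten_even (b : β) (Ds : List (List (β × Bool))) (h : ∀ D ∈ Ds, Even (cnt b D)) :
    Even (cnt b Ds.flatten) := by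
  induction Ds with
  | nil => simp
  | cons D Ds ih =>
    simp only [List.flatten_cons, cnt_append]
    exact (h D (by simp)).add (ih fun D' h' => h D' (by simp [h']))
end cnt

lemma mk_append (L M : List (β × Bool)) : (mk (L ++ M) : FreeGroup β) = mk L * mk M := by
  rw [mul_mk]
lemma mk_cons (p : β × Bool) (M : List (β × Bool)) :
    (mk (p :: M) : FreeGroup β) = mk [p] * mk M := by
  rw [mul_mk]; rfl
lemma mk_invRev (L : List (β × Bool)) : (mk (invRev L) : FreeGroup β) = (mk L)⁻¹ := by
  rw [inv_mk]
lemma mk_flip (b : β) (s : Bool) : (mk [(b, !s)] : FreeGroup β) = (mk [(b, s)])⁻¹ := by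
  rw [inv_mk]; rfl
lemma mk_cons2 (Q : List (β × Bool)) (p q : β × Bool) :
    (mk (p :: q :: Q) : FreeGroup β) = mk [p] * (mk [q] * mk Q) := by
  simp only [mul_mk, List.singleton_append]
lemma mk_flatten (L : List (List (β × Bool))) :
    (mk L.flatten : FreeGroup β) = (L.map mk).prod := by
  induction L with
  | nil => rfl
  | cons a L ih => simp [mk_append, ih]

/-! ### signed substitutions and lifting -/

def sub (f : β → α × Bool) (p : β × Bool) : α × Bool := ((f p.1).1, (f p.1).2 == p.2)

lemma lift_sub (f : β → α × Bool) (L : List (β × Bool)) :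
    FreeGroup.lift (fun b => (mk [f b] : FreeGroup α)) (mk L) = mk (L.map (sub f)) := by
  induction L with
  | nil => simp [← one_eq_mk]
  | cons p L ih =>
    rw [mk_cons, map_mul, ih, List.map_cons, mk_cons (sub f p)]
    congr 1
    obtain ⟨b, s⟩ := p
    cases s
    · simp [sub, invRev]
    · simp [sub]

lemma sub_sub {γ : Type*} (f : β → α × Bool) (h : γ → β × Bool) (p : γ × Bool) :
    sub f (sub h p) = sub (fun c => sub f (h c)) p := by
  simp only [sub, Prod.mk.injEq, true_and]
  cases (f (h p.1).1).2 <;> cases (h p.1).2 <;> cases p.2 <;> rfl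

lemma norm_lift_sub [DecidableEq α] [DecidableEq β] (f : β → α × Bool) (w : FreeGroup β) :
    (FreeGroup.lift (fun b => (mk [f b] : FreeGroup α)) w).norm ≤ w.norm := by
  conv_lhs => rw [← FreeGroup.mk_toWord (x := w), lift_sub]
  exact FreeGroup.norm_mk_le.trans (by simp [FreeGroup.norm])

lemma exists_cancel [DecidableEq α] (L : List (α × Bool)) (hne : L ≠ [])
    (h : (mk L : FreeGroup α) = 1) :
    ∃ P Q : List (α × Bool), ∃ p : α × Bool, L = P ++ p :: (p.1, !p.2) :: Q := by
  by_contra hcon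
  push Not at hcon
  have hr : FreeGroup.IsReduced L := by
    apply FreeGroup.IsReduced.of_forall_not_step
    intro L₂ hs
    cases hs with
    | @not P Q x b => exact hcon P Q (x, b) rfl
  have h1 := hr.reduce_eq
  rw [← FreeGroup.toWord_mk, h, FreeGroup.toWord_one] at h1
  exact hne h1.symm

lemma lifting [DecidableEq α] [DecidableEq β] (ℓ : β → α × Bool) (n : ℕ) :
    ∀ W K : List (β × Bool), W.length ≤ n →
    (∀ b, cnt b W + cnt b K = 0 ∨ cnt b W + cnt b K = 2) →
    (mk (W.map (sub ℓ)) : FreeGroup α) = 1 →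
    ∃ σ : β → β × Bool, (∀ b, sub ℓ (σ b) = ℓ b) ∧
      (mk (W.map (sub σ)) : FreeGroup β) = 1 ∧
      ∀ b, cnt b (K.map (sub σ)) = 0 ∨ cnt b (K.map (sub σ)) = 2 := by
  have hid : ∀ L : List (β × Bool), L.map (sub fun b => (b, true)) = L := by
    intro L
    conv_rhs => rw [← List.map_id L]
    apply List.map_congr_left
    rintro ⟨b, s⟩ _
    cases s <;> rfl
  induction n with
  | zero =>
    intro W K hW hc h1
    obtain rfl : W = [] := by simpa using hW
    refine ⟨fun b => (b, true), fun b => ?_, rfl, ?_⟩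
    · simp [sub]
    · rw [hid]
      simpa using hc
  | succ n ih =>
    intro W K hW hc h1
    by_cases hne : W = []
    · subst hne
      exact ih [] K (by simp) hc h1
    obtain ⟨P', Q', p', hL⟩ := exists_cancel _ (by simpa using hne) h1
    obtain ⟨P, R, rfl, hP, hR⟩ := List.map_eq_append_iff.1 hL
    obtain ⟨p, R, rfl, hp, hR⟩ := List.map_eq_cons_iff.1 hR
    obtain ⟨q, Q, rfl, hq, hQ⟩ := List.map_eq_cons_iff.1 hR
    obtain ⟨p, s⟩ := p
    obtain ⟨q, t⟩ := q
    subst hp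
    by_cases hpq : p = q
    · subst hpq
      have hst : t = !s := by
        simp only [sub, Prod.mk.injEq, true_and] at hq
        revert hq
        cases (ℓ p).2 <;> cases s <;> cases t <;> simp
      subst hst
      obtain ⟨σ, h2, h3, h4⟩ := ih (P ++ Q) K (by simp at hW ⊢; omega) (by
        intro b
        have := hc b
        by_cases hb : b = p
        · subst hb
          simp at this ⊢
          omega
        · simpa [cnt_cons, Ne.symm hb] using this) (by
        rw [← h1]
        simp only [List.map_append, List.map_cons, mk_cons2, mk_append]
        have : (mk [sub ℓ (p, !s)] : FreeGroup α) = (mk [sub ℓ (p, s)])⁻¹ := by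
          rw [hq, mk_flip]
        rw [this]
        group)
      refine ⟨σ, h2, ?_, h4⟩
      rw [← h3]
      simp only [List.map_append, List.map_cons, mk_cons2, mk_append]
      have : (mk [sub σ (p, !s)] : FreeGroup β) = (mk [sub σ (p, s)])⁻¹ := by
        rw [← mk_flip]
        simp only [sub]
        cases (σ p).2 <;> cases s <;> rfl
      rw [this]
      group
    · -- identify `q` with `p`
      set τ : β → β × Bool := fun b => if b = q then (p, (!s) == t) else (b, true) with hτ
      have hlab : ∀ b, sub ℓ (τ b) = ℓ b := by
        intro b
        by_cases hb : b = q
        · subst hb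
          simp only [hτ, if_true]
          simp only [sub, Prod.mk.injEq] at hq ⊢
          refine Prod.ext hq.1.symm ?_
          simp only
          have h5 := hq.2
          revert h5
          cases (ℓ p).2 <;> cases (ℓ b).2 <;> cases s <;> cases t <;> simp
        · simp [hτ, hb, sub]
      have hcomp : ∀ L : List (β × Bool), (L.map (sub τ)).map (sub ℓ) = L.map (sub ℓ) := by
        intro L
        rw [List.map_map]
        apply List.map_congr_left
        intro x _
        simp only [Function.comp, sub_sub, hlab]
      have hcq : ∀ L : List (β × Bool), cnt q (L.map (sub τ)) = 0 := by
        intro L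
        induction L with
        | nil => simp
        | cons x L ih =>
          rw [List.map_cons, cnt_cons, ih]
          by_cases hx : x.1 = q <;> simp [sub, hτ, hx, hpq]
      have hcp : ∀ L : List (β × Bool), cnt p (L.map (sub τ)) = cnt p L + cnt q L := by
        intro L
        induction L with
        | nil => simp
        | cons x L ih =>
          rw [List.map_cons, cnt_cons, ih, cnt_cons, cnt_cons]
          by_cases hx : x.1 = q
          · simp [sub, hτ, hx, Ne.symm hpq]; omega
          · simp [sub, hτ, hx]; omega
      have hco : ∀ b, b ≠ p → b ≠ q → ∀ L : List (β × Bool), cnt b (L.map (sub τ)) = cnt b L := by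
        intro b hb hb' L
        induction L with
        | nil => simp
        | cons x L ih =>
          rw [List.map_cons, cnt_cons, ih, cnt_cons]
          by_cases hx : x.1 = q
          · simp [sub, hτ, hx, Ne.symm hb, Ne.symm hb']
          · simp [sub, hτ, hx]
      obtain ⟨σ, h2, h3, h4⟩ := ih ((P ++ Q).map (sub τ)) (K.map (sub τ))
        (by simp at hW ⊢; omega) (by
        intro b
        by_cases hb : b = q
        · subst hb
          simp only [hcq]; simp
        by_cases hb' : b = p
        · subst hb'
          have e1 := hc b
          have e2 := hc q
          simp only [hcp]
          simp [cnt_cons, hpq, Ne.symm hpq] at e1 e2 ⊢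
          omega
        · have := hc b
          simp only [hco b hb' hb]
          simpa [cnt_cons, Ne.symm hb, Ne.symm hb'] using this) (by
        rw [hcomp, ← h1]
        simp only [List.map_append, List.map_cons, mk_cons2, mk_append]
        have : (mk [sub ℓ (q, t)] : FreeGroup α) = (mk [sub ℓ (p, s)])⁻¹ := by
          rw [hq, mk_flip]
        rw [this]
        group)
      have hc2 : ∀ L : List (β × Bool),
          L.map (sub fun b => sub σ (τ b)) = (L.map (sub τ)).map (sub σ) := by
        intro L
        rw [List.map_map]
        apply List.map_congr_left
        intro x _
        simp only [Function.comp, sub_sub]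
      refine ⟨fun b => sub σ (τ b), ?_, ?_, ?_⟩
      · intro b
        rw [sub_sub, ← hlab b]
        congr 1
        funext c
        exact h2 c
      · rw [hc2, ← h3]
        simp only [List.map_append, List.map_cons, mk_cons2, mk_append]
        have : (mk [sub σ (sub τ (q, t))] : FreeGroup β) = (mk [sub σ (sub τ (p, s))])⁻¹ := by
          rw [← mk_flip]
          simp only [sub, hτ, hpq, if_true, if_false]
          cases (σ p).2 <;> cases s <;> cases t <;> rfl
        rw [this]
        group
      · intro b
        rw [hc2]
        exact h4 b

end QE


namespace QE
open FreeGroup (mk invRev mul_mk inv_mk one_eq_mk)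

variable {α β : Type*}

/-! ### products of conjugates -/

/-- `CP l y`: `y` is a product of conjugates of the entries of `l`, in this order. -/
inductive CP {G : Type*} [Group G] : List G → G → Prop
  | nil : CP [] 1
  | cons (c : G) (l : List G) (y w : G) : CP l y → CP (c :: l) (w⁻¹ * c * w * y)

lemma CP.map {G H : Type*} [Group G] [Group H] (f : G →* H) {l : List G} {y : G} (h : CP l y) :
    CP (l.map f) (f y) := by
  induction h with
  | nil => simpa using CP.nil
  | cons c l y w _ ih => simpa using CP.cons (f c) _ _ (f w) ih

lemma CP.perm {G : Type*} [Group G] {l l' : List G} (hp : l.Perm l') :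
    ∀ {y : G}, CP l y → CP l' y := by
  induction hp with
  | nil => exact fun h => h
  | cons x _ ih =>
    intro y h
    cases h with
    | cons _ _ y w h => exact CP.cons _ _ _ _ (ih h)
  | swap a b l =>
    intro y h
    cases h with
    | cons _ _ y w h =>
      cases h with
      | cons _ _ y v h =>
        have := CP.cons a _ _ (v * (w⁻¹ * b * w)⁻¹) (CP.cons b l y w h)
        convert this using 1
        group
  | trans _ _ ih1 ih2 => exact fun h => ih2 (ih1 h)

/-- the equation of genus `g` with coefficients `l` has a solution -/
def Solv {G : Type*} [Group G] (g : ℕ) (l : List G) : Prop :=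
  ∃ xs : List G, xs.length = g ∧ CP l (xs.map (fun a => a ^ 2)).prod

lemma Solv.map {G H : Type*} [Group G] [Group H] (f : G →* H) {g : ℕ} {l : List G}
    (h : Solv g l) : Solv g (l.map f) := by
  obtain ⟨xs, hx, h⟩ := h
  refine ⟨xs.map f, by simpa using hx, ?_⟩
  have := h.map f
  rw [map_list_prod, List.map_map] at this
  rw [List.map_map]
  have e : xs.map ((fun a => a ^ 2) ∘ f) = xs.map (f ∘ fun a => a ^ 2) :=
    List.map_congr_left fun a _ => by simp
  rw [e]
  exact this

lemma Solv.perm {G : Type*} [Group G] {g : ℕ} {l l' : List G} (hp : l.Perm l') (h : Solv g l) :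
    Solv g l' := by
  obtain ⟨xs, hx, h⟩ := h
  exact ⟨xs, hx, h.perm hp⟩

lemma Solv.of_one_cons {G : Type*} [Group G] {g : ℕ} {l : List G} (h : Solv g (1 :: l)) :
    Solv g l := by
  obtain ⟨xs, hx, h⟩ := h
  refine ⟨xs, hx, ?_⟩
  generalize (xs.map (fun a => a ^ 2)).prod = y at h
  cases h with
  | cons _ _ y w h => simpa using h

section
variable [DecidableEq β]

/-- product of conjugates with conjugators of length at most `n` -/
inductive BC (n : ℕ) : List (FreeGroup β) → FreeGroup β → Prop
  | nil : BC n [] 1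
  | cons (c : FreeGroup β) (l : List (FreeGroup β)) (y w : FreeGroup β) :
      w.norm ≤ n → BC n l y → BC n (c :: l) (w⁻¹ * c * w * y)

/-- product of conjugates of elements or their inverses,
with conjugators of length at most `n` -/
inductive SBC (n : ℕ) : List (FreeGroup β) → FreeGroup β → Prop
  | nil : SBC n [] 1
  | cons (c : FreeGroup β) (l : List (FreeGroup β)) (y w v : FreeGroup β) :
      w.norm ≤ n → (v = c ∨ v = c⁻¹) → SBC n l y → SBC n (c :: l) (w⁻¹ * v * w * y)

lemma norm_mul3 (a b c : FreeGroup β) : (a * b * c).norm ≤ a.norm + b.norm + c.norm :=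
  (FreeGroup.norm_mul_le _ _).trans (Nat.add_le_add_right (FreeGroup.norm_mul_le _ _) _)

lemma SBC.norm_le {n : ℕ} {l : List (FreeGroup β)} {y : FreeGroup β} (h : SBC n l y) :
    y.norm ≤ (l.map fun u => 2 * n + u.norm).sum := by
  induction h with
  | nil => simp
  | cons c l y w v hw hv _ ih =>
    have h1 := FreeGroup.norm_mul_le (w⁻¹ * v * w) y
    have h2 := norm_mul3 w⁻¹ v w
    have h3 : v.norm = c.norm := by rcases hv with rfl | rfl <;> simp [FreeGroup.norm_inv_eq]
    rw [FreeGroup.norm_inv_eq] at h2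
    simp only [List.map_cons, List.sum_cons]
    omega

lemma SBC.split {n : ℕ} {l1 : List (FreeGroup β)} : ∀ {l2 : List (FreeGroup β)}
    {u y : FreeGroup β}, SBC n (l1 ++ u :: l2) y → ∃ P Q w v : FreeGroup β, w.norm ≤ n ∧
      (v = u ∨ v = u⁻¹) ∧ y = P * (w⁻¹ * v * w) * Q ∧ SBC n (l1 ++ l2) (P * Q) ∧
      P.norm + Q.norm + (2 * n + u.norm) ≤ ((l1 ++ u :: l2).map fun u => 2 * n + u.norm).sum := by
  induction l1 with
  | nil =>
    intro l2 u y h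
    cases h with
    | cons _ _ y w v hw hv h =>
      refine ⟨1, y, w, v, hw, hv, by group, by simpa using h, ?_⟩
      have := h.norm_le
      simp only [List.nil_append, List.map_cons, List.sum_cons, FreeGroup.norm_one]
      omega
  | cons c l1 ih =>
    intro l2 u y h
    cases h with
    | cons _ _ y w v hw hv h =>
      obtain ⟨P, Q, w', v', h1, h2, rfl, h4, h5⟩ := ih h
      refine ⟨w⁻¹ * v * w * P, Q, w', v', h1, h2, by group, ?_, ?_⟩
      · rw [mul_assoc]
        exact SBC.cons c _ _ w v hw hv h4
      · have g1 := FreeGroup.norm_mul_le (w⁻¹ * v * w) P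
        have g2 := norm_mul3 w⁻¹ v w
        have g3 : v.norm = c.norm := by rcases hv with rfl | rfl <;> simp [FreeGroup.norm_inv_eq]
        rw [FreeGroup.norm_inv_eq] at g2
        simp only [List.cons_append, List.map_cons, List.sum_cons] at h5 ⊢
        omega

lemma BC.mono {n n' : ℕ} (hn : n ≤ n') {l : List (FreeGroup β)} {y : FreeGroup β} (h : BC n l y) :
    BC n' l y := by
  induction h with
  | nil => exact BC.nil
  | cons c l y w hw _ ih => exact BC.cons c l y w (hw.trans hn) ih

/-- Correcting the signs and the order, at the expense of changing one square. -/
lemma unflip (n L : ℕ) : ∀ (t l : List (FreeGroup β)) (y x : FreeGroup β), t.Perm l → SBC n l y →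
    (l.map fun u => 2 * n + u.norm).sum ≤ L →
    ∃ x' Y : FreeGroup β, BC (n + x.norm + 2 * t.length * L) t Y ∧ Y * x' ^ 2 = y * x ^ 2 ∧
      x'.norm ≤ x.norm + 2 * t.length * L := by
  intro t
  induction t with
  | nil =>
    intro l y x hp h _
    obtain rfl : l = [] := by simpa using hp
    cases h
    exact ⟨x, 1, BC.nil, rfl, by omega⟩
  | cons u t ih =>
    intro l y x hp h hL
    obtain ⟨l1, l2, rfl⟩ := List.append_of_mem (hp.subset (List.mem_cons_self))
    have hp' : t.Perm (l1 ++ l2) := (hp.trans List.perm_middle).cons_inv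
    obtain ⟨P, Q, w, v, hw, hv, rfl, h4, h5⟩ := h.split
    have hL' : ((l1 ++ l2).map fun u => 2 * n + u.norm).sum ≤ L := by
      simp at hL ⊢; omega
    have hlen : 2 * (u :: t).length * L = 2 * t.length * L + 2 * L := by
      simp only [List.length_cons]; ring
    rw [hlen]
    rcases hv with hv | hv <;> subst hv
    · obtain ⟨x', Y, g1, g2, g3⟩ := ih _ _ x hp' h4 hL'
      refine ⟨x', ((w * P⁻¹)⁻¹ * v * (w * P⁻¹)) * Y, ?_, ?_, by omega⟩
      · refine BC.cons _ _ _ _ ?_ (g1.mono (by omega))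
        have := FreeGroup.norm_mul_le w P⁻¹
        rw [FreeGroup.norm_inv_eq] at this
        omega
      · rw [mul_assoc _ Y, g2]
        group
    · set a := Q⁻¹ * (w⁻¹ * u⁻¹ * w) * Q with ha
      have na : a.norm ≤ 2 * L - P.norm := by
        have e1 := norm_mul3 Q⁻¹ (w⁻¹ * u⁻¹ * w) Q
        have e2 := norm_mul3 w⁻¹ u⁻¹ w
        simp only [FreeGroup.norm_inv_eq, ← ha] at e1 e2
        omega
      have nax := FreeGroup.norm_mul_le a x
      obtain ⟨x', Y, g1, g2, g3⟩ := ih _ _ (a * x) hp' h4 hL'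
      set K := w * (Q * (x⁻¹ * (Q⁻¹ * ((w⁻¹ * u * w) * P⁻¹)))) with hK
      refine ⟨x', (K⁻¹ * u * K) * Y, ?_, ?_, by omega⟩
      · refine BC.cons _ _ _ _ ?_ (g1.mono (by omega))
        have e1 := FreeGroup.norm_mul_le w (Q * (x⁻¹ * (Q⁻¹ * ((w⁻¹ * u * w) * P⁻¹))))
        have e2 := FreeGroup.norm_mul_le Q (x⁻¹ * (Q⁻¹ * ((w⁻¹ * u * w) * P⁻¹)))
        have e3 := FreeGroup.norm_mul_le x⁻¹ (Q⁻¹ * ((w⁻¹ * u * w) * P⁻¹))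
        have e4 := FreeGroup.norm_mul_le Q⁻¹ ((w⁻¹ * u * w) * P⁻¹)
        have e5 := FreeGroup.norm_mul_le (w⁻¹ * u * w) P⁻¹
        have e6 := norm_mul3 w⁻¹ u w
        simp only [FreeGroup.norm_inv_eq, ← hK] at e1 e2 e3 e4 e5 e6 ⊢
        omega
      · rw [mul_assoc _ Y, g2, hK, ha]
        simp only [pow_two]
        group

lemma BC.ofFn {n k : ℕ} (f : Fin k → FreeGroup β) (c : FreeGroup β) : ∀ {Y : FreeGroup β},
    BC n (List.ofFn f ++ [c]) Y → ∃ (w : Fin k → FreeGroup β) (w0 : FreeGroup β),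
      (∀ j, (w j).norm ≤ n) ∧ w0.norm ≤ n ∧
      Y = (List.ofFn fun j => (w j)⁻¹ * f j * w j).prod * (w0⁻¹ * c * w0) := by
  induction k with
  | zero =>
    intro Y h
    simp only [List.ofFn_zero, List.nil_append] at h
    cases h with
    | cons _ _ y w hw h =>
      cases h
      exact ⟨fun _ => 1, w, fun j => j.elim0, hw, by simp⟩
  | succ k ih =>
    intro Y h
    rw [List.ofFn_succ, List.cons_append] at h
    cases h with
    | cons _ _ y v hv h =>
      obtain ⟨w, w0, h1, h2, rfl⟩ := ih _ h
      refine ⟨Fin.cons v w, w0, ?_, h2, ?_⟩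
      · intro j
        refine Fin.cases ?_ (fun j => ?_) j
        · simpa using hv
        · simpa using h1 j
      · rw [List.ofFn_succ]
        simp [mul_assoc]

/-! ### merging the coefficients -/

lemma lift_fix (b : β) (v : FreeGroup β) (L : List (β × Bool)) (h : cnt b L = 0) :
    FreeGroup.lift (fun x => if x = b then v else FreeGroup.of x) (mk L) = mk L := by
  induction L with
  | nil => simp [← one_eq_mk]
  | cons p L ih =>
    rw [cnt_cons] at h
    have hp : p.1 ≠ b := by
      intro hp; simp [hp] at h
    rw [mk_cons, map_mul, ih (by omega)]
    congr 1
    obtain ⟨c, s⟩ := p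
    simp only at hp
    cases s <;> simp [hp, FreeGroup.of, invRev]

lemma merge_all (g n : ℕ) : ∀ (k : ℕ) (rest Ds : List (List (β × Bool))) (W : List (β × Bool))
    (l : List (FreeGroup β)), rest.length = k →
    (∀ b, Even (cnt b W + cnt b Ds.flatten + cnt b rest.flatten) ∧
      cnt b W + cnt b Ds.flatten + cnt b rest.flatten ≤ 2) →
    (∀ D ∈ Ds, ∀ b, Even (cnt b D)) →
    Solv g ((W :: Ds ++ rest).map mk : List (FreeGroup β)) →
    SBC n l (mk (W ++ Ds.flatten)) →
    W.length + Ds.flatten.length + rest.flatten.length ≤ n + 1 →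
    ∃ (l' : List (FreeGroup β)) (Es : List (List (β × Bool))),
      SBC n l' (mk Es.flatten) ∧ l'.Perm (l ++ rest.map mk) ∧
      (∀ b, Even (cnt b Es.flatten) ∧ cnt b Es.flatten ≤ 2) ∧
      (∀ D ∈ Es, ∀ b, Even (cnt b D)) ∧
      Solv g (Es.map mk : List (FreeGroup β)) ∧
      Es.flatten.length ≤ n + 1 := by
  intro k
  induction k with
  | zero =>
    intro rest Ds W l hk hc hD hS hB hl
    obtain rfl : rest = [] := by simpa using hk
    refine ⟨l, W :: Ds, by simpa using hB, by simp, ?_, ?_, by simpa using hS, by simpa using hl⟩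
    · simpa using hc
    · intro D hDm b
      rcases List.mem_cons.1 hDm with rfl | hDm
      · have h1 := (hc b).1
        have h2 := cnt_flatten_even b Ds fun D h => hD D h b
        simp only [List.flatten_nil, cnt_nil, add_zero] at h1
        exact (Nat.even_add.1 h1).2 h2
      · exact hD D hDm b
  | succ k ih =>
    intro rest Ds W l hk hc hD hS hB hl
    by_cases hex : ∃ U ∈ rest, ∃ b, 0 < cnt b W ∧ 0 < cnt b U
    · obtain ⟨U, hU, b, hbW, hbU⟩ := hex
      obtain ⟨r1, r2, rfl⟩ := List.append_of_mem hU
      obtain ⟨s, hs⟩ := cnt_pos.1 hbW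
      obtain ⟨t, ht⟩ := cnt_pos.1 hbU
      obtain ⟨P, Q, rfl⟩ := List.append_of_mem hs
      -- orient `U`
      obtain ⟨A, B, hV⟩ : ∃ A B : List (β × Bool), ∃ V, V = A ++ (b, !s) :: B ∧
          ((mk V : FreeGroup β) = mk U ∨ (mk V : FreeGroup β) = (mk U)⁻¹) ∧
          (∀ c, cnt c V = cnt c U) ∧ V.length = U.length := by
        obtain ⟨A, B, rfl⟩ := List.append_of_mem ht
        by_cases hst : t = !s
        · subst hst
          exact ⟨A, B, _, rfl, Or.inl rfl, fun _ => rfl, rfl⟩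
        · refine ⟨invRev B, invRev A, invRev (A ++ (b, t) :: B), ?_, Or.inr ?_, ?_, ?_⟩
          · have : s = t := by revert hst; cases s <;> cases t <;> simp
            subst this
            simp [invRev]
          · rw [mk_invRev]
          · intro c; rw [cnt_invRev]
          · rw [FreeGroup.invRev_length]
      obtain ⟨V, rfl, hVU, hVc, hVl⟩ := hV
      have hb := (hc b).2
      have hbV := hVc b
      simp only [List.flatten_append, List.flatten_cons, cnt_append, cnt_cons_self] at hb hbV
      set a : FreeGroup β := mk A with haA
      set b' : FreeGroup β := mk B with hbB
      set p : FreeGroup β := mk P with hpP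
      set q : FreeGroup β := mk Q with hqQ
      set e : FreeGroup β := mk [(b, s)] with he
      have hVm : (mk (A ++ (b, !s) :: B) : FreeGroup β) = a * e⁻¹ * b' := by
        rw [mk_append, mk_cons, mk_flip]; group; rfl
      have hWm : (mk (P ++ (b, s) :: Q) : FreeGroup β) = p * e * q := by
        rw [mk_append, mk_cons]; group; rfl
      have hlen1 : (P ++ (b, s) :: Q).length = P.length + Q.length + 1 := by simp; omega
      have hlen2 : U.length = A.length + B.length + 1 := by rw [← hVl]; simp; omega
      rw [hlen1] at hl
      simp only [List.flatten_append, List.flatten_cons, List.length_append] at hl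
      obtain ⟨l', Es, h1, h2, h3⟩ := ih (r1 ++ r2) Ds (P ++ B ++ A ++ Q) (mk U :: l)
        (by simp at hk ⊢; omega) (by
          intro c
          have h1 := hc c
          have h2 := hVc c
          simp only [List.flatten_append, List.flatten_cons, cnt_append, cnt_cons] at h1 h2 ⊢
          by_cases hcb : b = c
          · simp only [hcb, if_true] at h1 h2
            constructor
            · obtain ⟨m, hm⟩ := h1.1
              exact ⟨m - 1, by omega⟩
            · omega
          · simp only [hcb, if_false] at h1 h2
            constructor
            · convert h1.1 using 1; omega
            · omega) hD (by
          set v : FreeGroup β := if s then b' * a else (b' * a)⁻¹ with hv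
          set θ := FreeGroup.lift (fun x => if x = b then v else FreeGroup.of x) with hθ
          have hfix : ∀ L : List (β × Bool), cnt b L = 0 → θ (mk L) = mk L :=
            fun L hL => lift_fix b v L hL
          have hθe : θ e = b' * a := by
            rw [he, hθ, hv]
            cases s <;> simp
          have hA : θ a = a := hfix A (by omega)
          have hB' : θ b' = b' := hfix B (by omega)
          have hP : θ p = p := hfix P (by omega)
          have hQ : θ q = q := hfix Q (by omega)
          have hV1 : θ (mk (A ++ (b, !s) :: B)) = 1 := by
            rw [hVm]; simp only [map_mul, map_inv, hA, hB', hθe]; group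
          have hU1 : θ (mk U) = 1 := by
            rcases hVU with h | h
            · rw [← h, hV1]
            · rw [h, map_inv] at hV1
              simpa using hV1
          have hW1 : θ (mk (P ++ (b, s) :: Q)) = mk (P ++ B ++ A ++ Q) := by
            rw [hWm]; simp only [map_mul, hP, hQ, hθe, mk_append]
            group; rfl
          have key := hS.map θ
          have hmap : ∀ Ls : List (List (β × Bool)), cnt b Ls.flatten = 0 →
              (Ls.map mk).map θ = Ls.map mk := by
            intro Ls hLs
            induction Ls with
            | nil => rfl
            | cons M Ls ih =>
              simp only [List.flatten_cons, cnt_append] at hLs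
              simp only [List.map_cons]
              rw [hfix M (by omega), ih (by omega)]
          apply Solv.of_one_cons
          refine Solv.perm ?_ key
          simp only [List.map_append, List.map_cons, hU1, hW1, List.cons_append]
          rw [hmap Ds (by omega), hmap r1 (by omega), hmap r2 (by omega)]
          refine List.Perm.trans ?_ (List.Perm.swap _ _ _)
          refine List.Perm.cons _ ?_
          rw [← List.append_assoc]
          refine List.perm_middle.trans ?_
          rw [List.append_assoc]) (by
          have hw : (a * e⁻¹ * p⁻¹).norm ≤ n := by
            have e1 := norm_mul3 a e⁻¹ p⁻¹
            have e2 : a.norm ≤ A.length := FreeGroup.norm_mk_le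
            have e3 : p.norm ≤ P.length := FreeGroup.norm_mk_le
            have e4 : e.norm ≤ 1 := FreeGroup.norm_mk_le
            simp only [FreeGroup.norm_inv_eq] at e1
            omega
          have := SBC.cons (mk U) l _ (a * e⁻¹ * p⁻¹) (mk (A ++ (b, !s) :: B)) hw hVU hB
          convert this using 1
          rw [hVm, mk_append _ Ds.flatten, mk_append _ Ds.flatten, hWm]
          simp only [mk_append, ← haA, ← hbB, ← hpP, ← hqQ]
          group) (by
          simp only [List.flatten_append, List.length_append]
          omega)
      refine ⟨l', Es, h1, h2.trans ?_, h3⟩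
      simp only [List.map_append, List.map_cons, List.cons_append]
      rw [← List.append_assoc, ← List.append_assoc]
      exact List.perm_middle.symm
    · push Not at hex
      cases rest with
      | nil => simp at hk
      | cons U rest =>
        have hWeven : ∀ b, Even (cnt b W) := by
          intro b
          rcases Nat.eq_zero_or_pos (cnt b W) with h0 | h0
          · simp [h0]
          · have hz : cnt b (U :: rest).flatten = 0 := by
              by_contra hne
              obtain ⟨s, hs⟩ := cnt_pos.1 (Nat.pos_of_ne_zero hne)
              obtain ⟨M, hM, hsM⟩ := List.mem_flatten.1 hs
              have := hex M hM b h0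
              have := cnt_pos.2 ⟨s, hsM⟩
              omega
            have h1 := (hc b).1
            have h2 := cnt_flatten_even b Ds fun D h => hD D h b
            rw [hz, add_zero] at h1
            exact (Nat.even_add.1 h1).2 h2
        obtain ⟨l', Es, h1, h2, h3⟩ := ih rest (W :: Ds) U (mk U :: l) (by simpa using hk) (by
          intro b
          have := hc b
          simp only [List.flatten_cons, cnt_append] at this ⊢
          constructor
          · convert this.1 using 1; omega
          · omega) (by
          intro D hDm
          rcases List.mem_cons.1 hDm with rfl | hDm
          · exact hWeven
          · exact hD D hDm) (by
          refine hS.perm (List.Perm.map _ ?_)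
          simp only [List.cons_append]
          exact (List.perm_middle (l₁ := W :: Ds))) (by
          have := SBC.cons (mk U) l _ 1 (mk U) (by simp) (Or.inl rfl) hB
          convert this using 1
          rw [List.flatten_cons, mk_append]
          group) (by
          simp only [List.flatten_cons, List.length_append] at hl ⊢
          omega)
        refine ⟨l', Es, h1, h2.trans ?_, h3⟩
        simp only [List.map_cons, List.cons_append]
        exact List.perm_middle.symm

end

end QE

namespace QE
open FreeGroup (mk invRev mul_mk inv_mk one_eq_mk)
variable {α β : Type*}

/-- mod 2 Heisenberg group -/
@[ext] structure Heis where
  a : ZMod 2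
  b : ZMod 2
  c : ZMod 2

instance : Group Heis where
  mul u v := ⟨u.a + v.a, u.b + v.b, u.c + v.c + u.a * v.b⟩
  one := ⟨0, 0, 0⟩
  inv u := ⟨-u.a, -u.b, -u.c + u.a * u.b⟩
  mul_assoc u v w := by
    apply Heis.ext
    · show u.a + v.a + w.a = u.a + (v.a + w.a); ring
    · show u.b + v.b + w.b = u.b + (v.b + w.b); ring
    · show (u.c + v.c + u.a * v.b) + w.c + (u.a + v.a) * w.b =
        u.c + (v.c + w.c + v.a * w.b) + u.a * (v.b + w.b)
      ring
  one_mul u := by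
    apply Heis.ext
    · show 0 + u.a = u.a; ring
    · show 0 + u.b = u.b; ring
    · show 0 + u.c + 0 * u.b = u.c; ring
  mul_one u := by
    apply Heis.ext
    · show u.a + 0 = u.a; ring
    · show u.b + 0 = u.b; ring
    · show u.c + 0 + u.a * 0 = u.c; ring
  inv_mul_cancel u := by
    apply Heis.ext
    · show -u.a + u.a = 0; ring
    · show -u.b + u.b = 0; ring
    · show (-u.c + u.a * u.b) + u.c + (-u.a) * u.b = 0; ring

lemma Heis.mul_a (u v : Heis) : (u * v).a = u.a + v.a := rfl
lemma Heis.mul_b (u v : Heis) : (u * v).b = u.b + v.b := rfl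
lemma Heis.mul_c (u v : Heis) : (u * v).c = u.c + v.c + u.a * v.b := rfl
lemma Heis.inv_a (u : Heis) : (u⁻¹).a = -u.a := rfl
lemma Heis.inv_b (u : Heis) : (u⁻¹).b = -u.b := rfl
lemma Heis.inv_c (u : Heis) : (u⁻¹).c = -u.c + u.a * u.b := rfl
lemma Heis.one_a : (1 : Heis).a = 0 := rfl
lemma Heis.one_b : (1 : Heis).b = 0 := rfl
lemma Heis.one_c : (1 : Heis).c = 0 := rfl

/-- the mod 2 character determined by `φ` -/
def chi (φ : β → ZMod 2) (w : FreeGroup β) : ZMod 2 :=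
  Multiplicative.toAdd (FreeGroup.lift (fun b => Multiplicative.ofAdd (φ b)) w)

lemma chi_one (φ : β → ZMod 2) : chi φ 1 = 0 := by simp [chi]
lemma chi_mul (φ : β → ZMod 2) (u v : FreeGroup β) : chi φ (u * v) = chi φ u + chi φ v := by
  simp [chi]
lemma chi_inv (φ : β → ZMod 2) (u : FreeGroup β) : chi φ u⁻¹ = chi φ u := by
  simp [chi, ZMod.neg_eq_self_mod_two]
lemma chi_nil (φ : β → ZMod 2) : chi φ (mk []) = 0 := chi_one φ
lemma chi_cons (φ : β → ZMod 2) (p : β × Bool) (L : List (β × Bool)) :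
    chi φ (mk (p :: L)) = φ p.1 + chi φ (mk L) := by
  rw [mk_cons, chi_mul]
  congr 1
  obtain ⟨b, s⟩ := p
  cases s <;> simp [chi, ZMod.neg_eq_self_mod_two]
lemma chi_single (φ : β → ZMod 2) (p : β × Bool) : chi φ (mk [p]) = φ p.1 := by
  rw [chi_cons, chi_nil, add_zero]

lemma chi_add (φ ψ : β → ZMod 2) (w : FreeGroup β) : chi (φ + ψ) w = chi φ w + chi ψ w := by
  induction w using FreeGroup.induction_on with
  | C1 => simp [chi_one]
  | of b => simp [chi]
  | inv_of b h => rw [chi_inv, chi_inv, chi_inv, h]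
  | mul x y hx hy => rw [chi_mul, chi_mul, chi_mul, hx, hy]; ring

section
variable [DecidableEq β]

lemma chi_congr {φ ψ : β → ZMod 2} {L : List (β × Bool)} (h : ∀ b, 0 < cnt b L → φ b = ψ b) :
    chi φ (mk L) = chi ψ (mk L) := by
  induction L with
  | nil => simp [chi_nil]
  | cons p L ih =>
    rw [chi_cons, chi_cons, ih, h]
    · rw [cnt_cons]; simp
    · intro b hb
      apply h
      rw [cnt_cons]; omega

lemma chi_update {φ : β → ZMod 2} {L : List (β × Bool)} {x : β} {t : ZMod 2} (h : cnt x L = 0) :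
    chi (Function.update φ x t) (mk L) = chi φ (mk L) := by
  apply chi_congr
  intro b hb
  rw [Function.update_of_ne]
  rintro rfl
  omega

lemma chi_even (φ : β → ZMod 2) : ∀ (n : ℕ) (L : List (β × Bool)), L.length ≤ n →
    (∀ b, Even (cnt b L)) → chi φ (mk L) = 0 := by
  intro n
  induction n with
  | zero =>
    intro L hL _
    obtain rfl : L = [] := by simpa using hL
    exact chi_nil φ
  | succ n ih =>
    intro L hL he
    cases L with
    | nil => exact chi_nil φ
    | cons p L =>
      have h1 : 0 < cnt p.1 L := by
        have := he p.1
        rw [cnt_cons] at this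
        simp only [if_true] at this
        rcases Nat.eq_zero_or_pos (cnt p.1 L) with h | h
        · rw [h] at this; simp at this
        · exact h
      obtain ⟨s, hs⟩ := cnt_pos.1 h1
      obtain ⟨A, B, rfl⟩ := List.append_of_mem hs
      have := ih (A ++ B) (by simp at hL ⊢; omega) (by
        intro b
        have := he b
        simp only [cnt_cons, cnt_append] at this ⊢
        by_cases hb : p.1 = b
        · simp only [hb, if_true] at this
          rw [Nat.even_iff] at this ⊢; omega
        · simpa [hb] using this)
      rw [chi_cons, mk_append, chi_mul, chi_cons]
      rw [mk_append, chi_mul] at this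
      simp only
      have h2 : φ p.1 + φ p.1 = 0 := CharTwo.add_self_eq_zero _
      linear_combination h2 + this

/-- the Heisenberg representation -/
def hd (φ ψ : β → ZMod 2) : FreeGroup β →* Heis :=
  FreeGroup.lift (fun b => (⟨φ b, ψ b, 0⟩ : Heis))

lemma hd_a (φ ψ : β → ZMod 2) (w : FreeGroup β) : (hd φ ψ w).a = chi φ w := by
  induction w using FreeGroup.induction_on with
  | C1 => simp [chi_one, Heis.one_a]
  | of b => simp [chi, hd]
  | inv_of b h => rw [map_inv, Heis.inv_a, h, chi_inv, ZMod.neg_eq_self_mod_two]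
  | mul x y hx hy => rw [map_mul, Heis.mul_a, chi_mul, hx, hy]

lemma hd_b (φ ψ : β → ZMod 2) (w : FreeGroup β) : (hd φ ψ w).b = chi ψ w := by
  induction w using FreeGroup.induction_on with
  | C1 => simp [chi_one, Heis.one_b]
  | of b => simp [chi, hd]
  | inv_of b h => rw [map_inv, Heis.inv_b, h, chi_inv, ZMod.neg_eq_self_mod_two]
  | mul x y hx hy => rw [map_mul, Heis.mul_b, chi_mul, hx, hy]

/-- product of squares -/
def sqp {G : Type*} [Group G] (l : List G) : G := (l.map (fun a => a ^ 2)).prod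
/-- product of commutators -/
def cmp {G : Type*} [Group G] (l : List (G × G)) : G :=
  (l.map (fun a => a.1 * a.2 * a.1⁻¹ * a.2⁻¹)).prod

lemma hd_sqp (φ ψ : β → ZMod 2) (l : List (FreeGroup β)) :
    (hd φ ψ (sqp l)).c = (l.map fun y => chi φ y * chi ψ y).sum ∧
      chi φ (sqp l) = 0 ∧ chi ψ (sqp l) = 0 := by
  induction l with
  | nil => simp [sqp, Heis.one_c, chi_one]
  | cons y l ih =>
    have e : sqp (y :: l) = y * y * sqp l := by simp [sqp, pow_two]
    have h2 : ∀ t : ZMod 2, t + t = 0 := fun t => CharTwo.add_self_eq_zero _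
    obtain ⟨h1, h3, h4⟩ := ih
    refine ⟨?_, ?_, ?_⟩
    · rw [e, map_mul, map_mul]
      simp only [Heis.mul_c, Heis.mul_a, hd_a, hd_b, h1, h3, h4, List.map_cons, List.sum_cons, h2]
      ring
    · rw [e, chi_mul, chi_mul, h3, h2]; simp
    · rw [e, chi_mul, chi_mul, h4, h2]; simp

lemma hd_cmp (φ ψ : β → ZMod 2) (l : List (FreeGroup β × FreeGroup β)) :
    (hd φ ψ (cmp l)).c =
      (l.map fun y => chi φ y.1 * chi ψ y.2 + chi φ y.2 * chi ψ y.1).sum ∧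
      chi φ (cmp l) = 0 ∧ chi ψ (cmp l) = 0 := by
  induction l with
  | nil => simp [cmp, Heis.one_c, chi_one]
  | cons y l ih =>
    obtain ⟨p, q⟩ := y
    have e : cmp ((p, q) :: l) = p * q * p⁻¹ * q⁻¹ * cmp l := by simp [cmp]
    have h2 : ∀ t : ZMod 2, t + t = 0 := fun t => CharTwo.add_self_eq_zero _
    obtain ⟨h1, h3, h4⟩ := ih
    refine ⟨?_, ?_, ?_⟩
    · rw [e]; simp only [map_mul, map_inv]
      simp only [Heis.mul_c, Heis.mul_a, Heis.inv_a, Heis.inv_b, Heis.inv_c, hd_a, hd_b, h1, h3,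
        h4, List.map_cons, List.sum_cons]
      linear_combination (-1) * h2 (chi φ q * chi ψ p)
    · rw [e]; simp only [chi_mul, chi_inv, h3]; linear_combination h2 (chi φ p) + h2 (chi φ q)
    · rw [e]; simp only [chi_mul, chi_inv, h4]; linear_combination h2 (chi ψ p) + h2 (chi ψ q)

lemma hd_CP (φ ψ : β → ZMod 2) {l : List (FreeGroup β)} {y : FreeGroup β} (h : CP l y)
    (hl : ∀ u ∈ l, chi φ u = 0 ∧ chi ψ u = 0) :
    (hd φ ψ y).c = (hd φ ψ l.prod).c ∧ chi φ l.prod = 0 ∧ chi ψ l.prod = 0 := by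
  induction h with
  | nil => simp [chi_one]
  | cons c l y w h ih =>
    obtain ⟨h1, h3, h4⟩ := ih fun u hu => hl u (List.mem_cons_of_mem _ hu)
    have hc := hl c (by simp)
    refine ⟨?_, ?_, ?_⟩
    · rw [List.prod_cons]; simp only [map_mul, map_inv]
      simp only [Heis.mul_c, Heis.mul_a, Heis.inv_a, Heis.inv_b, Heis.inv_c, hd_a, hd_b, h1, h3,
        h4, hc.1, hc.2]
      ring_nf
    · rw [List.prod_cons, chi_mul, hc.1, h3, add_zero]
    · rw [List.prod_cons, chi_mul, hc.2, h4, add_zero]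

end
end QE

namespace QE
open FreeGroup (mk invRev mul_mk inv_mk one_eq_mk)
variable {α β : Type*}

section
variable [DecidableEq β]

/-- independence of the characters of a decomposition -/
def Good (W : List (β × Bool)) (ys : List (FreeGroup β))
    (ps : List (FreeGroup β × FreeGroup β)) : Prop :=
  (∀ φ ψ : β → ZMod 2, (∀ b, 0 < cnt b W → φ b = ψ b) →
    ys.map (chi φ) = ys.map (chi ψ) ∧ ps.map (fun p => chi φ p.1) = ps.map (fun p => chi ψ p.1) ∧
    ps.map (fun p => chi φ p.2) = ps.map (fun p => chi ψ p.2)) ∧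
  (∀ (φ₀ : β → ZMod 2) (cs ds es : List (ZMod 2)), cs.length = ys.length →
    ds.length = ps.length → es.length = ps.length →
    ∃ φ : β → ZMod 2, (∀ b, cnt b W = 0 → φ b = φ₀ b) ∧ ys.map (chi φ) = cs ∧
      ps.map (fun p => chi φ p.1) = ds ∧ ps.map (fun p => chi φ p.2) = es)

lemma Good.nil : Good ([] : List (β × Bool)) [] [] := by
  refine ⟨by simp, fun φ₀ cs ds es h1 h2 h3 => ⟨φ₀, by simp, ?_⟩⟩
  simp_all

lemma Good.mono {W W' : List (β × Bool)} {ys : List (FreeGroup β)}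
    {ps : List (FreeGroup β × FreeGroup β)} (h : Good W ys ps)
    (hW : ∀ b, cnt b W ≤ cnt b W') : Good W' ys ps := by
  refine ⟨fun φ ψ hb => h.1 φ ψ fun b hb' => hb b (by have := hW b; omega), ?_⟩
  intro φ₀ cs ds es h1 h2 h3
  obtain ⟨φ, h4, h5⟩ := h.2 φ₀ cs ds es h1 h2 h3
  exact ⟨φ, fun b hb => h4 b (by have := hW b; omega), h5⟩

lemma Good.cons_sq {W W' : List (β × Bool)} {ys : List (FreeGroup β)}
    {ps : List (FreeGroup β × FreeGroup β)} (h : Good W ys ps)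
    (hW : ∀ b, cnt b W ≤ cnt b W') (x : β) (hx : cnt x W = 0) (hx' : 0 < cnt x W')
    (y : FreeGroup β) (V : List (β × Bool)) (hV : cnt x V = 0) (hVW : ∀ b, cnt b V ≤ cnt b W')
    (hy : ∀ φ, chi φ y = φ x + chi φ (mk V)) : Good W' (y :: ys) ps := by
  refine ⟨fun φ ψ hb => ?_, ?_⟩
  · have h1 := h.1 φ ψ fun b hb' => hb b (by have := hW b; omega)
    refine ⟨?_, h1.2⟩
    rw [List.map_cons, List.map_cons, h1.1, hy, hy, hb x hx',
      chi_congr (φ := φ) (ψ := ψ) fun b hb' => hb b (by have := hVW b; omega)]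
  · intro φ₀ cs ds es h1 h2 h3
    cases cs with
    | nil => simp at h1
    | cons c cs =>
      obtain ⟨φ, h4, h5, h6, h7⟩ := h.2 φ₀ cs ds es (by simpa using h1) h2 h3
      let ψ := Function.update φ x (c - chi φ (mk V))
      obtain ⟨e1, e2, e3⟩ := h.1 ψ φ (by
        intro b hb
        apply Function.update_of_ne
        rintro rfl; omega)
      refine ⟨ψ, ?_, ?_, e2.trans h6, e3.trans h7⟩
      · intro b hb
        have : ψ b = φ b := Function.update_of_ne (by rintro rfl; omega) _ _
        rw [this]
        exact h4 b (by have := hW b; omega)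
      · rw [List.map_cons, e1, h5, hy, chi_update hV]
        simp [ψ]

lemma Good.cons_comm {W W' : List (β × Bool)} {ys : List (FreeGroup β)}
    {ps : List (FreeGroup β × FreeGroup β)} (h : Good W ys ps)
    (hW : ∀ b, cnt b W ≤ cnt b W') (x y : β) (hxy : x ≠ y) (hx : cnt x W = 0) (hx' : 0 < cnt x W')
    (hy : cnt y W = 0) (hy' : 0 < cnt y W')
    (p q : FreeGroup β) (V U : List (β × Bool)) (hV : ∀ b, cnt b V ≤ cnt b W)
    (hU : ∀ b, cnt b U ≤ cnt b W)
    (hp : ∀ φ, chi φ p = φ x + chi φ (mk V)) (hq : ∀ φ, chi φ q = φ y + chi φ (mk U)) :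
    Good W' ys ((p, q) :: ps) := by
  have hVx := hV x
  have hVy := hV y
  have hUx := hU x
  have hUy := hU y
  refine ⟨fun φ ψ hb => ?_, ?_⟩
  · have h1 := h.1 φ ψ fun b hb' => hb b (by have := hW b; omega)
    refine ⟨h1.1, ?_, ?_⟩
    · rw [List.map_cons, List.map_cons, h1.2.1, hp, hp, hb x hx',
        chi_congr (φ := φ) (ψ := ψ) fun b hb' => hb b (by have := hV b; have := hW b; omega)]
    · rw [List.map_cons, List.map_cons, h1.2.2, hq, hq, hb y hy',
        chi_congr (φ := φ) (ψ := ψ) fun b hb' => hb b (by have := hU b; have := hW b; omega)]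
  · intro φ₀ cs ds es h1 h2 h3
    cases ds with
    | nil => simp at h2
    | cons d ds =>
      cases es with
      | nil => simp at h3
      | cons e es =>
        obtain ⟨φ, h4, h5, h6, h7⟩ := h.2 φ₀ cs ds es h1 (by simpa using h2) (by simpa using h3)
        let ψ := Function.update (Function.update φ x (d - chi φ (mk V))) y (e - chi φ (mk U))
        have hne : ∀ b, b ≠ x → b ≠ y → ψ b = φ b := by
          intro b h1 h2
          simp only [ψ, Function.update_of_ne h2, Function.update_of_ne h1]
        obtain ⟨e1, e2, e3⟩ := h.1 ψ φ (by
          intro b hb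
          apply hne <;> (rintro rfl; omega))
        have hVV : chi ψ (mk V) = chi φ (mk V) := by
          simp only [ψ]; rw [chi_update (by omega), chi_update (by omega)]
        have hUU : chi ψ (mk U) = chi φ (mk U) := by
          simp only [ψ]; rw [chi_update (by omega), chi_update (by omega)]
        refine ⟨ψ, ?_, e1.trans h5, ?_, ?_⟩
        · intro b hb
          rw [hne b (by rintro rfl; omega) (by rintro rfl; omega)]
          exact h4 b (by have := hW b; omega)
        · rw [List.map_cons, e2, h6, hp, hVV]
          have : ψ x = d - chi φ (mk V) := by simp [ψ, Function.update_of_ne hxy]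
          rw [this]; simp
        · rw [List.map_cons, e3, h7, hq, hUU]
          have : ψ y = e - chi φ (mk U) := by simp [ψ]
          rw [this]; simp

/-- in an orientable word one finds a cancelling pair or a linked pair of pairs -/
lemma find_pattern (n : ℕ) : ∀ (A B C : List (β × Bool)) (x : β) (s : Bool),
    B.length ≤ n → (A ++ (x, s) :: B ++ (x, !s) :: C).Nodup →
    (∀ y t, (y, t) ∈ A ++ (x, s) :: B ++ (x, !s) :: C →
      (y, !t) ∈ A ++ (x, s) :: B ++ (x, !s) :: C) →
    (∃ A' C' y t, A ++ (x, s) :: B ++ (x, !s) :: C = A' ++ (y, t) :: (y, !t) :: C') ∨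
    (∃ A' B' C' D' E' y t z u, A ++ (x, s) :: B ++ (x, !s) :: C =
      A' ++ (y, t) :: B' ++ (z, u) :: C' ++ (y, !t) :: D' ++ (z, !u) :: E') := by
  induction n with
  | zero =>
    intro A B C x s hB hN hc
    obtain rfl : B = [] := by simpa using hB
    exact Or.inl ⟨A, C, x, s, by simp⟩
  | succ n ih =>
    intro A B C x s hB hN hc
    cases B with
    | nil => exact Or.inl ⟨A, C, x, s, by simp⟩
    | cons q B =>
      obtain ⟨y, t⟩ := q
      have h := hc y t (by simp)
      have hyx : y ≠ x := by
        rintro rfl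
        by_cases hst : t = s
        · subst hst
          simp [List.nodup_append] at hN
        · have : t = !s := by revert hst; cases s <;> cases t <;> simp
          subst this
          simp [List.nodup_append] at hN
      simp only [List.mem_append, List.mem_cons, Prod.mk.injEq, hyx, false_and, false_or] at h
      rcases h with (h | h | h) | h
      · obtain ⟨A1, A2, rfl⟩ := List.append_of_mem h
        exact Or.inr ⟨A1, A2, [], B, C, y, !t, x, s, by simp⟩
      · exfalso; revert h; cases t <;> simp
      · obtain ⟨B1, B2, rfl⟩ := List.append_of_mem h
        have e : A ++ (x, s) :: (y, t) :: (B1 ++ (y, !t) :: B2) ++ (x, !s) :: C =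
          (A ++ [(x, s)]) ++ (y, t) :: B1 ++ (y, !t) :: (B2 ++ (x, !s) :: C) := by simp
        rw [e] at hN hc ⊢
        exact ih _ _ _ _ _ (by simp at hB; omega) hN hc
      · obtain ⟨C1, C2, rfl⟩ := List.append_of_mem h
        exact Or.inr ⟨A, [], B, C1, C2, x, s, y, t, by simp⟩

lemma decompose (N : ℕ) : ∀ (n : ℕ) (W : List (β × Bool)), W.length ≤ n → W.length ≤ N →
    (∀ b, Even (cnt b W) ∧ cnt b W ≤ 2) →
    ∃ (ys : List (FreeGroup β)) (ps : List (FreeGroup β × FreeGroup β)),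
      mk W = sqp ys * cmp ps ∧ 4 * ps.length ≤ W.length ∧
      (∀ y ∈ ys, y.norm ≤ 2 * N) ∧ (∀ p ∈ ps, p.1.norm ≤ 2 * N ∧ p.2.norm ≤ 2 * N) ∧
      Good W ys ps ∧ (W.Nodup → ys = []) := by
  intro n
  induction n with
  | zero =>
    intro W hW _ _
    obtain rfl : W = [] := by simpa using hW
    exact ⟨[], [], by simp [sqp, cmp, ← one_eq_mk], by simp, by simp, by simp, Good.nil, by simp⟩
  | succ n ih =>
    intro W hW hN hc
    by_cases hnd : W.Nodup
    · cases hWe : W with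
      | nil =>
        exact ⟨[], [], by simp [sqp, cmp, ← one_eq_mk], by simp, by simp, by simp, Good.nil,
          by simp⟩
      | cons p0 W0 =>
      rw [← hWe]
      have hcl : ∀ y t, (y, t) ∈ W → (y, !t) ∈ W := by
        intro y t hm
        have h0 : cnt y W = 2 := by
          have h1 := hc y
          have h2 := cnt_pos.2 ⟨t, hm⟩
          obtain ⟨⟨k, hk⟩, h3⟩ := h1
          omega
        rw [cnt_eq_add] at h0
        have h1 := List.nodup_iff_count_le_one.1 hnd (y, true)
        have h2 := List.nodup_iff_count_le_one.1 hnd (y, false)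
        cases t
        · exact List.count_pos_iff.1 (by simp only [Bool.not_true, Bool.not_false]; omega)
        · exact List.count_pos_iff.1 (by simp only [Bool.not_true, Bool.not_false]; omega)
      obtain ⟨x0, s0⟩ := p0
      have hm : (x0, !s0) ∈ W0 := by
        have := hcl x0 s0 (by simp [hWe])
        rw [hWe] at this
        simpa using this
      obtain ⟨B0, C0, rfl⟩ := List.append_of_mem hm
      have hWe' : W = [] ++ (x0, s0) :: B0 ++ (x0, !s0) :: C0 := by simp [hWe]
      have hpat := find_pattern B0.length [] B0 C0 x0 s0 le_rfl (hWe' ▸ hnd) (hWe' ▸ hcl)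
      rw [← hWe'] at hpat
      clear hWe hWe' hm
      rcases hpat with ⟨A, C, y, t, rfl⟩ | ⟨A, B, C, D, E, y, t, z, u, rfl⟩
      · have hcc : ∀ b, cnt b (A ++ (y, t) :: (y, !t) :: C) =
            cnt b (A ++ C) + if y = b then 2 else 0 := by
          intro b
          simp only [cnt_append, cnt_cons]
          split_ifs <;> omega
        have hlen : (A ++ (y, t) :: (y, !t) :: C).length = (A ++ C).length + 2 := by simp; omega
        obtain ⟨ys, ps, h1, h2, h3, h4, h5, h6⟩ := ih (A ++ C) (by omega) (by omega) (by
          intro b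
          have := hc b
          rw [hcc] at this
          rw [Nat.even_iff] at *
          split_ifs at this <;> omega)
        refine ⟨ys, ps, ?_, by omega, h3, h4, h5.mono (by intro b; rw [hcc]; omega), ?_⟩
        · rw [← h1, mk_append, mk_append, mk_cons, mk_cons (y, !t), mk_flip]; group
        · intro _
          apply h6
          refine hnd.sublist ?_
          exact (List.Sublist.refl A).append ((List.sublist_cons_self _ _).trans
            (List.sublist_cons_self _ _))
      · have hcc : ∀ b, cnt b (A ++ (y, t) :: B ++ (z, u) :: C ++ (y, !t) :: D ++ (z, !u) :: E) =
            cnt b (A ++ D ++ C ++ B ++ E) + (if y = b then 2 else 0) + if z = b then 2 else 0 := by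
          intro b
          simp only [cnt_append, cnt_cons]
          split_ifs <;> omega
        have hlen : (A ++ (y, t) :: B ++ (z, u) :: C ++ (y, !t) :: D ++ (z, !u) :: E).length =
            A.length + B.length + C.length + D.length + E.length + 4 := by simp; omega
        have hlen' : (A ++ D ++ C ++ B ++ E).length =
            A.length + B.length + C.length + D.length + E.length := by simp; omega
        have hyz : y ≠ z := by
          rintro rfl
          have := (hc y).2
          rw [hcc] at this
          simp at this
        have hy0 := (hc y).2
        have hz0 := (hc z).2
        rw [hcc] at hy0 hz0
        simp only [if_true] at hy0 hz0
        obtain ⟨ys, ps, h1, h2, h3, h4, h5, h6⟩ := ih (A ++ D ++ C ++ B ++ E) (by omega) (by omega)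
          (by
          intro b
          have := hc b
          rw [hcc] at this
          rw [Nat.even_iff] at *
          split_ifs at this <;> omega)
        have hnd' : (A ++ D ++ C ++ B ++ E).Nodup := by
          have hs : (A ++ B ++ C ++ D ++ E).Sublist
              (A ++ (y, t) :: B ++ (z, u) :: C ++ (y, !t) :: D ++ (z, !u) :: E) := by
            refine (((List.Sublist.append ?_ ?_).append ?_).append ?_).append ?_
            · exact List.Sublist.refl _
            all_goals exact List.sublist_cons_self _ _
          refine (List.Perm.nodup_iff ?_).1 (hnd.sublist hs)
          rw [List.perm_iff_count]
          intro a
          simp only [List.count_append]; omega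
        obtain rfl := h6 hnd'
        have eA : (mk A : FreeGroup β).norm ≤ A.length := FreeGroup.norm_mk_le
        have eB : (mk B : FreeGroup β).norm ≤ B.length := FreeGroup.norm_mk_le
        have eC : (mk C : FreeGroup β).norm ≤ C.length := FreeGroup.norm_mk_le
        have eD : (mk D : FreeGroup β).norm ≤ D.length := FreeGroup.norm_mk_le
        have ey : (mk [(y, t)] : FreeGroup β).norm ≤ 1 := FreeGroup.norm_mk_le
        have ez : (mk [(z, u)] : FreeGroup β).norm ≤ 1 := FreeGroup.norm_mk_le
        set P : FreeGroup β := mk A * mk [(y, t)] * (mk C)⁻¹ * (mk D)⁻¹ * (mk A)⁻¹ with hP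
        set Q : FreeGroup β := mk A * mk D * mk C * mk B * mk [(z, u)] * (mk D)⁻¹ * (mk A)⁻¹ with hQ
        have h2c : ∀ t : ZMod 2, t + t = 0 := fun t => CharTwo.add_self_eq_zero _
        refine ⟨[], (P, Q) :: ps, ?_, ?_, by simp, ?_, ?_, by simp⟩
        · have e : cmp ((P, Q) :: ps) = P * Q * P⁻¹ * Q⁻¹ * cmp ps := by simp [cmp]
          have h1' : cmp ps = mk (A ++ D ++ C ++ B ++ E) := by rw [h1]; simp [sqp]
          rw [e, h1', hP, hQ]
          simp only [mk_append]
          rw [mk_cons (y, t), mk_cons (z, u), mk_cons (y, !t), mk_cons (z, !u), mk_flip, mk_flip]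
          simp only [sqp, List.map_nil, List.prod_nil]
          group
        · rw [List.length_cons]; omega
        · intro p hp
          rcases List.mem_cons.1 hp with rfl | hp
          · constructor
            · have n1 := norm_mul3 (mk A * mk [(y, t)] * (mk C)⁻¹) (mk D)⁻¹ (mk A)⁻¹
              have n2 := norm_mul3 (mk A) (mk [(y, t)]) (mk C)⁻¹
              simp only [FreeGroup.norm_inv_eq] at n1 n2
              simp only [hP]
              omega
            · have n1 := norm_mul3 (mk A * mk D * mk C * mk B * mk [(z, u)]) (mk D)⁻¹ (mk A)⁻¹
              have n2 := norm_mul3 (mk A * mk D * mk C) (mk B) (mk [(z, u)])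
              have n3 := norm_mul3 (mk A) (mk D) (mk C)
              simp only [FreeGroup.norm_inv_eq] at n1 n2 n3
              simp only [hQ]
              omega
          · exact h4 p hp
        · refine h5.cons_comm (by intro b; rw [hcc]; omega) y z hyz (by omega)
            (by rw [hcc]; simp) (by omega) (by rw [hcc]; simp) P Q (C ++ D) (C ++ B) ?_ ?_ ?_ ?_
          · intro b; simp only [cnt_append]; omega
          · intro b; simp only [cnt_append]; omega
          · intro φ
            rw [hP]; simp only [chi_mul, chi_inv, chi_single, mk_append]
            linear_combination h2c (chi φ (mk A))
          · intro φ
            rw [hQ]; simp only [chi_mul, chi_inv, chi_single, mk_append]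
            linear_combination h2c (chi φ (mk A)) + h2c (chi φ (mk D))
    · obtain ⟨p, hp⟩ : ∃ p, [p, p].Sublist W := by
        rw [List.nodup_iff_sublist] at hnd
        push Not at hnd
        exact hnd
      obtain ⟨A, W1, rfl, hA, hW1⟩ := List.cons_sublist_iff.1 hp
      obtain ⟨A1, A2, rfl⟩ := List.append_of_mem hA
      obtain ⟨B1, C, rfl⟩ := List.append_of_mem (List.singleton_sublist.1 hW1)
      obtain ⟨B, hB⟩ : ∃ B, B = A2 ++ B1 := ⟨_, rfl⟩
      have hWe : (A1 ++ p :: A2 ++ (B1 ++ p :: C)) = A1 ++ p :: B ++ p :: C := by simp [hB]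
      rw [hWe] at hW hN hc hnd ⊢
      clear hWe hB hp hA hW1
      have hcc : ∀ b, cnt b (A1 ++ p :: B ++ p :: C) =
          cnt b (A1 ++ invRev B ++ C) + if p.1 = b then 2 else 0 := by
        intro b
        simp only [cnt_append, cnt_cons, cnt_invRev]
        split_ifs <;> omega
      have hlen : (A1 ++ p :: B ++ p :: C).length = A1.length + B.length + C.length + 2 := by
        simp; omega
      have hlen' : (A1 ++ invRev B ++ C).length = A1.length + B.length + C.length := by
        simp [FreeGroup.invRev_length]; omega
      have hx0 := (hc p.1).2
      rw [hcc] at hx0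
      simp only [if_true] at hx0
      obtain ⟨ys, ps, h1, h2, h3, h4, h5, h6⟩ := ih (A1 ++ invRev B ++ C) (by omega) (by omega) (by
        intro b
        have := hc b
        rw [hcc] at this
        rw [Nat.even_iff] at *
        split_ifs at this <;> omega)
      have eA : (mk A1 : FreeGroup β).norm ≤ A1.length := FreeGroup.norm_mk_le
      have eB : (mk B : FreeGroup β).norm ≤ B.length := FreeGroup.norm_mk_le
      have ey : (mk [p] : FreeGroup β).norm ≤ 1 := FreeGroup.norm_mk_le
      have h2c : ∀ t : ZMod 2, t + t = 0 := fun t => CharTwo.add_self_eq_zero _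
      refine ⟨(mk A1 * mk [p] * mk B * (mk A1)⁻¹) :: ys, ps, ?_, by omega, ?_, h4, ?_,
        fun h => absurd h hnd⟩
      · have e : ∀ y : FreeGroup β, sqp (y :: ys) = y * y * sqp ys := by
          intro y; simp [sqp, pow_two]
        rw [e, mul_assoc _ (sqp ys), ← h1]
        simp only [mk_append, mk_invRev]
        rw [mk_cons p B, mk_cons p C]
        group
      · intro y hy
        rcases List.mem_cons.1 hy with rfl | hy
        · have n1 := norm_mul3 (mk A1 * mk [p]) (mk B) (mk A1)⁻¹
          have n2 := FreeGroup.norm_mul_le (mk A1) (mk [p])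
          simp only [FreeGroup.norm_inv_eq] at n1
          omega
        · exact h3 y hy
      · refine h5.cons_sq (by intro b; rw [hcc]; omega) p.1 (by omega) (by rw [hcc]; simp) _ B ?_ ?_ ?_
        · simp only [cnt_append, cnt_invRev] at hx0; omega
        · intro b; simp only [cnt_append, cnt_cons]; omega
        · intro φ
          simp only [chi_mul, chi_inv, chi_single]
          linear_combination h2c (chi φ (mk A1))

end
end QE

namespace QE
open FreeGroup (mk invRev mul_mk inv_mk one_eq_mk)
variable {α β : Type*}

section
variable [DecidableEq β]

/-- evaluation of characters as a linear map -/
def evl {k : ℕ} (a : Fin k → FreeGroup β) : (β → ZMod 2) →ₗ[ZMod 2] (Fin k → ZMod 2) :=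
  AddMonoidHom.toZModLinearMap 2
    { toFun := fun φ i => chi φ (a i)
      map_zero' := by
        funext i
        have := chi_add (0 : β → ZMod 2) 0 (a i)
        simpa using this
      map_add' := fun φ ψ => by
        funext i
        exact chi_add φ ψ (a i) }

lemma evl_apply {k : ℕ} (a : Fin k → FreeGroup β) (φ : β → ZMod 2) (i : Fin k) :
    evl a φ i = chi φ (a i) := rfl

lemma rank_fin {g r h : ℕ} (hg : 1 ≤ g) (a : Fin g → FreeGroup β) (y : Fin r → FreeGroup β)
    (p q : Fin h → FreeGroup β)
    (hs : ∀ (c : Fin r → ZMod 2) (d e : Fin h → ZMod 2), ∃ φ : β → ZMod 2,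
      (∀ i, chi φ (y i) = c i) ∧ (∀ i, chi φ (p i) = d i) ∧ ∀ i, chi φ (q i) = e i)
    (hq : ∀ φ ψ : β → ZMod 2, ∑ i, chi φ (a i) * chi ψ (a i) = ∑ i, chi φ (y i) * chi ψ (y i) +
      ∑ i, (chi φ (p i) * chi ψ (q i) + chi φ (q i) * chi ψ (p i))) :
    r + 2 * h ≤ g ∧ (r = 0 → 2 * h + 1 ≤ g) := by
  let A := evl a
  let Φ := (evl y).prod ((evl p).prod (evl q))
  have hΦ : Function.Surjective Φ := by
    rintro ⟨c, d, e⟩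
    obtain ⟨φ, h1, h2, h3⟩ := hs c d e
    refine ⟨φ, ?_⟩
    simp only [Φ, LinearMap.prod_apply, Prod.mk.injEq]
    refine Prod.ext (funext h1) (Prod.ext (funext h2) (funext h3))
  have hker : ∀ φ, A φ = 0 → Φ φ = 0 := by
    intro φ hφ
    have h0 : ∀ ψ, ∑ i, chi φ (y i) * chi ψ (y i) +
        ∑ i, (chi φ (p i) * chi ψ (q i) + chi φ (q i) * chi ψ (p i)) = 0 := by
      intro ψ
      rw [← hq]
      apply Finset.sum_eq_zero
      intro i _
      have : chi φ (a i) = 0 := congrFun hφ i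
      rw [this, zero_mul]
    refine Prod.ext (funext fun j => ?_) (Prod.ext (funext fun j => ?_) (funext fun j => ?_))
    · obtain ⟨ψ, h1, h2, h3⟩ := hs (Pi.single j 1) 0 0
      have := h0 ψ
      simp only [h1, h2, h3, Pi.zero_apply, mul_zero, add_zero, Finset.sum_const_zero,
        Pi.single_apply, mul_ite, mul_one, Finset.sum_ite_eq', Finset.mem_univ, if_true] at this
      exact this
    · obtain ⟨ψ, h1, h2, h3⟩ := hs 0 0 (Pi.single j 1)
      have := h0 ψ
      simp only [h1, h2, h3, Pi.zero_apply, mul_zero, add_zero, Finset.sum_const_zero, zero_add,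
        Pi.single_apply, mul_ite, mul_one, Finset.sum_ite_eq', Finset.mem_univ, if_true] at this
      exact this
    · obtain ⟨ψ, h1, h2, h3⟩ := hs 0 (Pi.single j 1) 0
      have := h0 ψ
      simp only [h1, h2, h3, Pi.zero_apply, mul_zero, add_zero, Finset.sum_const_zero, zero_add,
        Pi.single_apply, mul_ite, mul_one, Finset.sum_ite_eq', Finset.mem_univ, if_true] at this
      exact this
  obtain ⟨S, hS⟩ := A.rangeRestrict.exists_rightInverse_of_surjective A.range_rangeRestrict
  have hsur : Function.Surjective (Φ.comp S) := by
    intro v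
    obtain ⟨φ, rfl⟩ := hΦ v
    refine ⟨A.rangeRestrict φ, ?_⟩
    have h1 : A.rangeRestrict (S (A.rangeRestrict φ)) = A.rangeRestrict φ :=
      LinearMap.congr_fun hS _
    have h2 : A (S (A.rangeRestrict φ) - φ) = 0 := by
      rw [map_sub, sub_eq_zero]
      exact congrArg Subtype.val h1
    have h3 := hker _ h2
    rw [map_sub, sub_eq_zero] at h3
    exact h3
  have hfr := LinearMap.finrank_le_finrank_of_surjective hsur
  have hX : Module.finrank (ZMod 2) ((Fin r → ZMod 2) × (Fin h → ZMod 2) × (Fin h → ZMod 2)) =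
      r + 2 * h := by
    simp [Module.finrank_prod]; omega
  have hY : Module.finrank (ZMod 2) (Fin g → ZMod 2) = g := by simp
  have hle := Submodule.finrank_le (LinearMap.range A)
  rw [hX] at hfr
  rw [hY] at hle
  refine ⟨hfr.trans hle, ?_⟩
  rintro rfl
  by_contra hcon
  have htop : LinearMap.range A = ⊤ := by
    apply Submodule.eq_top_of_finrank_eq
    rw [hY]; omega
  obtain ⟨φ, hφ⟩ := LinearMap.range_eq_top.1 htop (Pi.single ⟨0, hg⟩ 1)
  have := hq φ φ
  have h1 : ∀ i, chi φ (a i) = (Pi.single ⟨0, hg⟩ 1 : Fin g → ZMod 2) i := fun i => congrFun hφ i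
  simp only [h1, Pi.single_apply, mul_ite, mul_one, mul_zero, Finset.univ_eq_empty,
    Finset.sum_empty, zero_add] at this
  rw [Finset.sum_eq_zero (s := (Finset.univ : Finset (Fin h)))] at this
  · simp at this
  · intro i _
    rw [mul_comm (chi φ (q i))]
    exact CharTwo.add_self_eq_zero _

lemma sum_map_fin {γ : Type*} (l : List γ) (f : γ → ZMod 2) :
    (l.map f).sum = ∑ i : Fin l.length, f (l.get i) := by
  rw [← List.sum_ofFn]
  congr 1
  exact (List.ofFn_getElem_eq_map l f).symm

lemma get_of_map {γ : Type*} (l : List γ) (f : γ → ZMod 2) (c : Fin l.length → ZMod 2)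
    (h : l.map f = List.ofFn c) (i : Fin l.length) : f (l.get i) = c i := by
  have e : List.ofFn (fun i : Fin l.length => f (l.get i)) = l.map f := List.ofFn_getElem_eq_map l f
  rw [← e] at h
  exact congrFun (List.ofFn_injective h) i

lemma rank_bound {g : ℕ} (hg : 1 ≤ g) (as ys : List (FreeGroup β)) (has : as.length = g)
    (ps : List (FreeGroup β × FreeGroup β)) (W : List (β × Bool)) (hG : Good W ys ps)
    (hq : ∀ φ ψ : β → ZMod 2, (as.map fun y => chi φ y * chi ψ y).sum =
      (ys.map fun y => chi φ y * chi ψ y).sum +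
      (ps.map fun y => chi φ y.1 * chi ψ y.2 + chi φ y.2 * chi ψ y.1).sum) :
    ys.length + 2 * ps.length ≤ g ∧ (ys.length = 0 → 2 * ps.length + 1 ≤ g) := by
  subst has
  apply rank_fin hg as.get ys.get (fun i => (ps.get i).1) (fun i => (ps.get i).2)
  · intro c d e
    obtain ⟨φ, -, h1, h2, h3⟩ := hG.2 0 (List.ofFn c) (List.ofFn d) (List.ofFn e) (by simp)
      (by simp) (by simp)
    exact ⟨φ, get_of_map ys _ c h1, get_of_map ps _ d h2, get_of_map ps _ e h3⟩
  · intro φ ψ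
    have := hq φ ψ
    rw [sum_map_fin, sum_map_fin, sum_map_fin] at this
    exact this

lemma sqp_append (l l' : List (FreeGroup β)) : sqp (l ++ l') = sqp l * sqp l' := by
  simp [sqp]

lemma sqp_replicate (n : ℕ) : sqp (List.replicate n (1 : FreeGroup β)) = 1 := by
  simp [sqp]

lemma sq_comm (M : ℕ) : ∀ (ps : List (FreeGroup β × FreeGroup β)) (a : FreeGroup β),
    (∀ p ∈ ps, p.1.norm ≤ M ∧ p.2.norm ≤ M) → ∃ es : List (FreeGroup β),
      es.length = 1 + 2 * ps.length ∧ sqp es = a ^ 2 * cmp ps ∧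
      ∀ e ∈ es, e.norm ≤ 3 * (a.norm + ps.length * M) + 4 * M := by
  intro ps
  induction ps with
  | nil =>
    intro a _
    refine ⟨[a], by simp, by simp [sqp, cmp], ?_⟩
    intro e he
    obtain rfl : e = a := by simpa using he
    omega
  | cons pq ps ih =>
    intro a hM
    obtain ⟨p, q⟩ := pq
    have hpq := hM (p, q) (by simp)
    simp only at hpq
    obtain ⟨es, h1, h2, h3⟩ := ih (a * p) fun p hp => hM p (List.mem_cons_of_mem _ hp)
    refine ⟨(a * a * p * q * p⁻¹ * a⁻¹) :: (a * p * q⁻¹ * p⁻¹ * a⁻¹ * p⁻¹ * a⁻¹) :: es, ?_, ?_, ?_⟩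
    · simp only [List.length_cons]; omega
    · have e : cmp ((p, q) :: ps) = p * q * p⁻¹ * q⁻¹ * cmp ps := by simp [cmp]
      have e2 : ∀ (y : FreeGroup β) ys, sqp (y :: ys) = y * y * sqp ys := by
        intro y ys; simp [sqp, pow_two]
      rw [e, e2, e2, h2]
      generalize cmp ps = Z
      rw [pow_two, pow_two]
      group
    · have hap := FreeGroup.norm_mul_le a p
      intro e he
      simp only [List.length_cons]
      rw [Nat.add_mul, one_mul]
      generalize ps.length * M = Z at *
      rcases List.mem_cons.1 he with rfl | he
      · have n1 := norm_mul3 (a * a * p * q) p⁻¹ a⁻¹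
        have n2 := norm_mul3 (a * a) p q
        have n3 := FreeGroup.norm_mul_le a a
        simp only [FreeGroup.norm_inv_eq] at n1 n2 n3
        omega
      rcases List.mem_cons.1 he with rfl | he
      · have n1 := norm_mul3 (a * p * q⁻¹ * p⁻¹ * a⁻¹) p⁻¹ a⁻¹
        have n2 := norm_mul3 (a * p * q⁻¹) p⁻¹ a⁻¹
        have n3 := norm_mul3 a p q⁻¹
        simp only [FreeGroup.norm_inv_eq] at n1 n2 n3
        omega
      · have := h3 e he
        omega

lemma squares {g N : ℕ} (hg : 1 ≤ g) (Es : List (List (β × Bool)))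
    (hc : ∀ b, Even (cnt b Es.flatten) ∧ cnt b Es.flatten ≤ 2)
    (hE : ∀ D ∈ Es, ∀ b, Even (cnt b D))
    (hS : Solv g (Es.map mk : List (FreeGroup β))) (hN : Es.flatten.length ≤ N) :
    ∃ es : List (FreeGroup β), es.length = g ∧ sqp es = mk Es.flatten ∧
      ∀ e ∈ es, 4 * e.norm ≤ 56 * N + 6 * N ^ 2 := by
  obtain ⟨ys, ps, h1, h2, h3, h4, h5, -⟩ := decompose N _ Es.flatten le_rfl hN hc
  obtain ⟨as, has, hCP⟩ := hS
  have hrank := rank_bound hg as ys has ps _ h5 (by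
    intro φ ψ
    have e1 := (hd_CP φ ψ hCP (by
      intro u hu
      obtain ⟨D, hD, rfl⟩ := List.mem_map.1 hu
      exact ⟨chi_even φ _ D le_rfl (hE D hD), chi_even ψ _ D le_rfl (hE D hD)⟩)).1
    rw [← mk_flatten, h1, map_mul, Heis.mul_c, (hd_sqp φ ψ ys).1, (hd_cmp φ ψ ps).1, hd_a, hd_b,
      (hd_sqp φ ψ ys).2.1, zero_mul, add_zero] at e1
    rw [← e1]
    exact (hd_sqp φ ψ as).1.symm)
  -- a first square
  obtain ⟨ys0, a, hya, ha, hl0, hy0⟩ : ∃ (ys0 : List (FreeGroup β)) (a : FreeGroup β),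
      sqp ys = sqp ys0 * a ^ 2 ∧ a.norm ≤ 2 * N ∧ ys0.length + 1 + 2 * ps.length ≤ g ∧
      ∀ y ∈ ys0, y.norm ≤ 2 * N := by
    rcases List.eq_nil_or_concat ys with rfl | ⟨ys0, a, rfl⟩
    · refine ⟨[], 1, by simp [sqp], by simp, ?_, by simp⟩
      have := hrank.2 rfl
      simp; omega
    · refine ⟨ys0, a, by simp [sqp], h3 a (by simp), ?_, fun y hy => h3 y (by simp [hy])⟩
      have := hrank.1
      simp only [List.concat_eq_append, List.length_append, List.length_singleton] at this
      exact this
  obtain ⟨es, h6, h7, h8⟩ := sq_comm (2 * N) ps a h4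
  refine ⟨ys0 ++ es ++ List.replicate (g - (ys0.length + 1 + 2 * ps.length)) 1, ?_, ?_, ?_⟩
  · simp only [List.length_append, List.length_replicate]; omega
  · rw [sqp_append, sqp_append, sqp_replicate, h7, h1, hya]; group
  · intro e he
    have hps : 4 * (ps.length * (2 * N)) ≤ 2 * N ^ 2 := by nlinarith
    rw [List.mem_append, List.mem_append] at he
    rcases he with (he | he) | he
    · have := hy0 e he
      omega
    · have := h8 e he
      omega
    · rw [List.eq_of_mem_replicate he]; simp

end
end QE

namespace QE
open FreeGroup (mk invRev mul_mk inv_mk one_eq_mk)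
variable {α β : Type*}

section
variable [DecidableEq β]

lemma bound_aux (s X m : ℕ) (hs : 2 ≤ s) (hm : m ≤ s) (hX : 4 * X ≤ 56 * s + 6 * s ^ 2) :
    3 * ((s - 1) + X + 2 * m * (2 * s * (s - 1) + s)) ≤ 12 * s ^ 4 := by
  obtain ⟨u, rfl⟩ : ∃ u, s = u + 2 := ⟨s - 2, by omega⟩
  have e : u + 2 - 1 = u + 1 := by omega
  rw [e]
  have h1 : 2 * m * (2 * (u + 2) * (u + 1) + (u + 2)) ≤
      2 * (u + 2) * (2 * (u + 2) * (u + 1) + (u + 2)) := by gcongr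
  have h2 : 4 * (3 * (u + 1 + X + 2 * m * (2 * (u + 2) * (u + 1) + (u + 2)))) ≤
      4 * (12 * (u + 2) ^ 4) := by
    have h3 : 12 * (u + 1) + 3 * (56 * (u + 2) + 6 * (u + 2) ^ 2) +
      12 * (2 * (u + 2) * (2 * (u + 2) * (u + 1) + (u + 2))) ≤ 48 * (u + 2) ^ 4 := by
      ring_nf
      have : u ≤ u ^ 2 := by nlinarith [Nat.le_self_pow (two_ne_zero) u]
      nlinarith [Nat.zero_le (u ^ 3), Nat.zero_le (u ^ 4)]
    omega
  omega

lemma sum_le_aux (n : ℕ) (t : List (List (β × Bool))) :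
    ((t.map mk : List (FreeGroup β)).map fun u => 2 * n + u.norm).sum ≤
      t.length * (2 * n) + t.flatten.length := by
  induction t with
  | nil => simp
  | cons W t ih =>
    have : (mk W : FreeGroup β).norm ≤ W.length := FreeGroup.norm_mk_le
    simp only [List.map_cons, List.sum_cons, List.length_cons, List.flatten_cons,
      List.length_append]
    rw [Nat.add_mul]
    omega

lemma length_le_flatten (t : List (List (β × Bool))) (h : ∀ W ∈ t, W ≠ []) :
    t.length ≤ t.flatten.length := by
  induction t with
  | nil => simp
  | cons W t ih =>
    have h1 := ih fun W hW => h W (List.mem_cons_of_mem _ hW)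
    have h2 := List.length_pos_iff.2 (h W (by simp))
    simp only [List.length_cons, List.flatten_cons, List.length_append]
    omega

lemma main_beta {g k : ℕ} (hg : 1 ≤ g) (U : Fin k → List (β × Bool)) (V : List (β × Bool))
    (hU : ∀ j, U j ≠ []) (hV : V ≠ [])
    (hc : ∀ b, cnt b (List.ofFn U ++ [V]).flatten = 0 ∨ cnt b (List.ofFn U ++ [V]).flatten = 2)
    (hS : Solv g ((List.ofFn U ++ [V]).map mk : List (FreeGroup β)))
    (s : ℕ) (hs : (List.ofFn U ++ [V]).flatten.length = s) :
    ∃ (w : Fin k → FreeGroup β) (e : Fin g → FreeGroup β),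
      (∀ j, (w j).norm ≤ 12 * s ^ 4) ∧ (∀ i, (e i).norm ≤ 12 * s ^ 4) ∧
      (List.ofFn fun j => (w j)⁻¹ * mk (U j) * w j).prod * mk V =
        (List.ofFn fun i => e i ^ 2).prod := by
  obtain ⟨t, ht⟩ : ∃ t, t = List.ofFn U ++ [V] := ⟨_, rfl⟩
  rw [← ht] at hc hS hs
  have htn : ∀ W ∈ t, W ≠ [] := by
    intro W hW
    rw [ht, List.mem_append] at hW
    rcases hW with hW | hW
    · obtain ⟨j, rfl⟩ := List.mem_ofFn.1 hW
      exact hU j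
    · obtain rfl : W = V := by simpa using hW
      exact hV
  have hm := length_le_flatten t htn
  have hs2 : 2 ≤ s := by
    obtain ⟨p, V', rfl⟩ := List.exists_cons_of_ne_nil hV
    have h1 : 0 < cnt p.1 t.flatten := by
      rw [ht, List.flatten_append, cnt_append]
      simp only [List.flatten_cons, List.flatten_nil, List.append_nil, cnt_cons, if_true]
      omega
    have h2 := hc p.1
    have h3 : cnt p.1 t.flatten ≤ t.flatten.length := by
      have := List.count_le_length (a := p.1) (l := t.flatten.map Prod.fst)
      rw [List.length_map] at this
      exact this
    omega
  have hte : ∃ W rest, t = W :: rest := by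
    rw [ht]; cases List.ofFn U <;> simp
  obtain ⟨W, rest, hWr⟩ := hte
  have hlen : W.length + rest.flatten.length = s := by
    rw [← hs, hWr]; simp
  obtain ⟨l', Es, h1, h2, h3, h4, h5, h6⟩ := merge_all g (s - 1) rest.length rest [] W [mk W] rfl
    (by
      intro b
      have := hc b
      rw [hWr, List.flatten_cons, cnt_append] at this
      simp only [List.flatten_nil, cnt_nil, add_zero]
      rcases this with h | h <;> rw [h] <;> simp) (by simp) (by
      rw [hWr] at hS
      simpa using hS) (by
      have := SBC.cons (n := s - 1) (mk W) [] 1 1 (mk W) (by simp) (Or.inl rfl) SBC.nil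
      simpa using this) (by simp only [List.flatten_nil, List.length_nil]; omega)
  have h2' : (t.map mk : List (FreeGroup β)).Perm l' := by
    rw [hWr]
    simpa using h2.symm
  obtain ⟨es, hel, hes, hen⟩ := squares (N := s) hg Es h3 h4 h5 (by omega)
  obtain ⟨es0, a, rfl⟩ : ∃ es0 a, es = es0 ++ [a] := by
    rcases List.eq_nil_or_concat es with rfl | ⟨es0, a, rfl⟩
    · simp at hel; omega
    · exact ⟨es0, a, by simp⟩
  have hX : ∃ X, 4 * X ≤ 56 * s + 6 * s ^ 2 ∧ ∀ e ∈ es0 ++ [a], e.norm ≤ X :=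
    ⟨(56 * s + 6 * s ^ 2) / 4, by omega, fun e he => by have := hen e he; omega⟩
  obtain ⟨X, hX, heX⟩ := hX
  obtain ⟨x', Y, hY, hYx, hx'⟩ := unflip (s - 1) (2 * s * (s - 1) + s) (t.map mk) l'
    (mk Es.flatten) a⁻¹ h2' h1 (by
      rw [← (h2'.map fun u => 2 * (s - 1) + u.norm).sum_eq]
      refine (sum_le_aux (s - 1) t).trans ?_
      rw [hs]
      have : t.length * (2 * (s - 1)) ≤ s * (2 * (s - 1)) := Nat.mul_le_mul_right _ (by omega)
      nlinarith)
  have haX := heX a (by simp)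
  rw [FreeGroup.norm_inv_eq] at hY hx'
  rw [List.length_map] at hY hx'
  have hB := bound_aux s X t.length hs2 (by omega) hX
  generalize hZ : 2 * t.length * (2 * s * (s - 1) + s) = Z at *
  have hYes : Y = sqp (es0 ++ [x'⁻¹]) := by
    rw [sqp_append] at hes ⊢
    have : Y * x' ^ 2 = sqp es0 := by
      rw [hYx, ← hes]; simp [sqp]
    rw [← this]; simp [sqp]
  have htm : (t.map mk : List (FreeGroup β)) = List.ofFn (fun j => mk (U j)) ++ [mk V] := by
    rw [ht, List.map_append, List.map_ofFn]; rfl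
  rw [htm] at hY
  obtain ⟨w, w0, hw, hw0, hYw⟩ := BC.ofFn _ _ hY
  have hlen2 : (es0 ++ [x'⁻¹]).length = g := by
    rw [← hel]; simp
  have hnb : ∀ e ∈ es0 ++ [x'⁻¹], e.norm ≤ s - 1 + X + Z := by
    intro e he
    rw [List.mem_append] at he
    rcases he with he | he
    · have := heX e (by simp [he]); omega
    · obtain rfl : e = x'⁻¹ := by simpa using he
      rw [FreeGroup.norm_inv_eq]; omega
  generalize es0 ++ [x'⁻¹] = fs at *
  subst hlen2
  refine ⟨fun j => w j * w0⁻¹, fun i => w0 * fs.get i * w0⁻¹, ?_, ?_, ?_⟩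
  · intro j
    have n1 := FreeGroup.norm_mul_le (w j) w0⁻¹
    rw [FreeGroup.norm_inv_eq] at n1
    have := hw j
    simp only
    omega
  · intro i
    have n1 := norm_mul3 w0 (fs.get i) w0⁻¹
    rw [FreeGroup.norm_inv_eq] at n1
    have := hnb (fs.get i) (List.get_mem _ _)
    simp only
    omega
  · have c1 : (List.ofFn fun j => (w j * w0⁻¹)⁻¹ * mk (U j) * (w j * w0⁻¹)).prod =
        MulAut.conj w0 (List.ofFn fun j => (w j)⁻¹ * mk (U j) * w j).prod := by
      rw [map_list_prod, List.map_ofFn]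
      congr 2
      funext j
      simp only [Function.comp, MulAut.conj_apply]
      group
    have c2 : (List.ofFn fun i => (w0 * fs.get i * w0⁻¹) ^ 2).prod = MulAut.conj w0 (sqp fs) := by
      rw [sqp, map_list_prod, List.map_map, ← List.ofFn_getElem_eq_map]
      congr 2
      funext j
      simp only [Function.comp, MulAut.conj_apply, conj_pow]
      rfl
    rw [c1, c2, ← hYes, hYw]
    simp only [map_mul, MulAut.conj_apply]
    group

end
end QE

namespace QE
open FreeGroup (mk invRev mul_mk inv_mk one_eq_mk)
variable {α β κ : Type*}

lemma CP.ofFn {G : Type*} [Group G] {k : ℕ} (f z : Fin k → G) (c : G) :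
    CP (List.ofFn f ++ [c]) ((List.ofFn fun j => (z j)⁻¹ * f j * z j).prod * c) := by
  induction k with
  | zero =>
    have := CP.cons c [] 1 1 CP.nil
    simpa using this
  | succ k ih =>
    have := CP.cons (f 0) _ _ (z 0) (ih (fun j => f j.succ) (fun j => z j.succ))
    simpa [List.ofFn_succ, mul_assoc] using this

/-- generic word for a tag -/
def tw (len : κ → ℕ) (k : κ) : List ((κ × ℕ) × Bool) :=
  (List.range (len k)).map fun i => ((k, i), true)

/-- replace signed tags by generic words -/
def expand (len : κ → ℕ) : List (κ × Bool) → List ((κ × ℕ) × Bool)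
  | [] => []
  | p :: τ => (if p.2 then tw len p.1 else invRev (tw len p.1)) ++ expand len τ

lemma expand_append (len : κ → ℕ) (τ τ' : List (κ × Bool)) :
    expand len (τ ++ τ') = expand len τ ++ expand len τ' := by
  induction τ with
  | nil => rfl
  | cons p τ ih => simp [expand, ih]

lemma cnt_tw [DecidableEq κ] (len : κ → ℕ) (k k' : κ) (i : ℕ) :
    cnt (k, i) (tw len k') = if i < len k then (if k' = k then 1 else 0) else 0 := by
  have aux : ∀ n : ℕ, cnt (k, i) ((List.range n).map fun i => ((k', i), true)) =
      if i < n then (if k' = k then 1 else 0) else 0 := by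
    intro n
    induction n with
    | zero => simp
    | succ n ih =>
      rw [List.range_succ, List.map_append, cnt_append, ih, List.map_singleton, cnt_cons, cnt_nil]
      by_cases hk : k' = k
      · simp only [hk, Prod.mk.injEq, true_and, if_true]
        split_ifs <;> omega
      · simp [hk]
  rw [tw, aux]
  by_cases hk : k' = k
  · rw [hk]
  · simp [hk]

lemma cnt_expand [DecidableEq κ] (len : κ → ℕ) (k : κ) (i : ℕ) (τ : List (κ × Bool)) :
    cnt (k, i) (expand len τ) = if i < len k then cnt k τ else 0 := by
  induction τ with
  | nil => simp [expand]
  | cons p τ ih =>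
    have : cnt (k, i) (if p.2 then tw len p.1 else invRev (tw len p.1)) =
        if i < len k then (if p.1 = k then 1 else 0) else 0 := by
      rw [← cnt_tw]; split_ifs
      · rfl
      · rw [cnt_invRev]
    rw [expand, cnt_append, this, ih, cnt_cons]
    split_ifs <;> omega

lemma mk_expand (len : κ → ℕ) (f : κ × ℕ → β × Bool) (τ : List (κ × Bool)) :
    (mk ((expand len τ).map (sub f)) : FreeGroup β) =
      FreeGroup.lift (fun k => (mk ((tw len k).map (sub f)) : FreeGroup β)) (mk τ) := by
  rw [← lift_sub]
  induction τ with
  | nil => simp [expand, ← one_eq_mk]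
  | cons p τ ih =>
    rw [expand, mk_append, map_mul, ih, mk_cons p τ, map_mul]
    congr 1
    obtain ⟨k, s⟩ := p
    cases s
    · simp only [Bool.false_eq_true, if_false]
      rw [mk_invRev, map_inv, lift_sub]
      simp
    · simp only [if_true]
      rw [lift_sub]
      simp

lemma expand_true (len : κ → ℕ) {n : ℕ} (c : Fin n → κ) :
    expand len (List.ofFn fun j => (c j, true)) = (List.ofFn fun j => tw len (c j)).flatten := by
  induction n with
  | zero => simp [expand]
  | succ n ih => simp [expand, List.ofFn_succ, ih]

lemma tw_map (word : κ → List (α × Bool)) (d : α × Bool) (k : κ) :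
    (tw (fun k => (word k).length) k).map (sub fun p => (word p.1).getD p.2 d) = word k := by
  apply List.ext_getElem
  · simp [tw]
  · intro i h1 h2
    simp [tw, sub, List.getD, List.getElem?_eq_getElem h2]

lemma cnt_flatten_ofFn [DecidableEq κ] {n : ℕ} (k : κ) (L : Fin n → List (κ × Bool)) :
    cnt k (List.ofFn L).flatten = ∑ i, cnt k (L i) := by
  induction n with
  | zero => simp
  | succ n ih => rw [List.ofFn_succ, List.flatten_cons, cnt_append, ih, Fin.sum_univ_succ]

lemma cnt_ofFn [DecidableEq κ] {n : ℕ} (k : κ) (c : Fin n → κ) :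
    cnt k (List.ofFn fun j => (c j, true)) = ∑ i, if c i = k then 1 else 0 := by
  induction n with
  | zero => simp
  | succ n ih => rw [List.ofFn_succ, cnt_cons, ih, Fin.sum_univ_succ, add_comm]

lemma length_flatten_ofFn {n : ℕ} (L : Fin n → List β) :
    (List.ofFn L).flatten.length = ∑ i, (L i).length := by
  induction n with
  | zero => simp
  | succ n ih => rw [List.ofFn_succ, List.flatten_cons, List.length_append, ih, Fin.sum_univ_succ]

/-- tags for the unknowns and coefficients -/
abbrev Tag (g k : ℕ) := Fin g ⊕ Fin k ⊕ Fin k ⊕ Unit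

lemma lift_tau {H : Type*} [Group H] {g k : ℕ} (tx : Fin g → κ) (tz tc : Fin k → κ) (t0 : κ)
    (f : κ → H) : FreeGroup.lift f
      (mk ((List.ofFn fun i => [(tx i, true), (tx i, true)]).flatten ++
      (List.ofFn fun j => [(tz j, false), (tc j, true), (tz j, true)]).flatten ++ [(t0, true)])) =
      (List.ofFn fun i => f (tx i) ^ 2).prod *
        (List.ofFn fun j => (f (tz j))⁻¹ * f (tc j) * f (tz j)).prod * f t0 := by
  simp only [mk_append, map_mul, mk_flatten, map_list_prod, List.map_map, List.map_ofFn]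
  congr 1
  · congr 1
    · congr 2
      funext i
      simp [Function.comp, pow_two]
    · congr 2
      funext i
      simp [Function.comp, mul_assoc]
  · simp

theorem main_thm [DecidableEq α] (g k : ℕ) (hg : 1 ≤ g)
    (Cj : Fin k → FreeGroup α) (C : FreeGroup α) (hCj : ∀ j, Cj j ≠ 1) (hC : C ≠ 1)
    (s : ℕ) (hs : s = (∑ j, (Cj j).norm) + C.norm)
    (x : Fin g → FreeGroup α) (z : Fin k → FreeGroup α)
    (hsol : (List.ofFn fun i => x i ^ 2).prod *
        (List.ofFn fun j => (z j)⁻¹ * Cj j * z j).prod * C = 1) :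
    ∃ w : Fin k → FreeGroup α, ∃ e : Fin g → FreeGroup α,
      (∀ j, (w j).norm ≤ 12 * s ^ 4) ∧
      (∀ i, (e i).norm ≤ 12 * s ^ 4) ∧
      (List.ofFn fun j => (w j)⁻¹ * Cj j * w j).prod * C =
        (List.ofFn fun i => e i ^ 2).prod := by
  have hne : ∀ u : FreeGroup α, u ≠ 1 → u.toWord ≠ [] := fun u hu h =>
    hu (FreeGroup.toWord_eq_nil_iff.1 h)
  obtain ⟨d, -, -⟩ := List.exists_cons_of_ne_nil (hne C hC)
  let tx : Fin g → Tag g k := Sum.inl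
  let tz : Fin k → Tag g k := fun j => Sum.inr (Sum.inl j)
  let tc : Fin k → Tag g k := fun j => Sum.inr (Sum.inr (Sum.inl j))
  let t0 : Tag g k := Sum.inr (Sum.inr (Sum.inr ()))
  let val : Tag g k → FreeGroup α := Sum.elim x (Sum.elim z (Sum.elim Cj fun _ => C))
  let word : Tag g k → List (α × Bool) := fun q => (val q).toWord
  let len : Tag g k → ℕ := fun q => (word q).length
  let ℓ : Tag g k × ℕ → α × Bool := fun p => (word p.1).getD p.2 d
  let τ : List (Tag g k × Bool) := (List.ofFn fun i => [(tx i, true), (tx i, true)]).flatten ++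
    (List.ofFn fun j => [(tz j, false), (tc j, true), (tz j, true)]).flatten ++ [(t0, true)]
  let τK : List (Tag g k × Bool) := (List.ofFn fun j => (tc j, true)) ++ [(t0, true)]
  have hℓ : ∀ q, (tw len q).map (sub ℓ) = word q := tw_map word d
  have hcount : ∀ q : Tag g k, cnt q τ + cnt q τK = 2 := by
    intro q
    simp only [τ, τK, cnt_append, cnt_flatten_ofFn, cnt_ofFn, cnt_cons, cnt_nil]
    rcases q with i | j | j | u
    · simp [tx, tz, tc, t0, Finset.sum_add_distrib]
    · simp [tx, tz, tc, t0, Finset.sum_add_distrib]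
    · simp [tx, tz, tc, t0, Finset.sum_add_distrib]
    · simp [tx, tz, tc, t0, Finset.sum_add_distrib]
  obtain ⟨σ, hσ1, hσ2, hσ3⟩ := lifting ℓ _ (expand len τ) (expand len τK) le_rfl (by
    rintro ⟨q, i⟩
    have := hcount q
    rw [cnt_expand, cnt_expand]
    split_ifs
    · exact Or.inr this
    · exact Or.inl rfl) (by
    rw [mk_expand]
    simp only [hℓ]
    have e : (fun q => (mk (word q) : FreeGroup α)) = val := by
      funext q; exact FreeGroup.mk_toWord
    rw [e, lift_tau tx tz tc t0]
    exact hsol)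
  let U : Fin k → List ((Tag g k × ℕ) × Bool) := fun j => (tw len (tc j)).map (sub σ)
  let V : List ((Tag g k × ℕ) × Bool) := (tw len t0).map (sub σ)
  have hK : (expand len τK).map (sub σ) = (List.ofFn U ++ [V]).flatten := by
    simp only [τK, expand_append, expand_true, List.map_append, List.map_flatten, List.map_ofFn,
      List.flatten_append]
    simp [expand, U, V, Function.comp_def]
  rw [hK] at hσ3
  rw [mk_expand, lift_tau tx tz tc t0] at hσ2
  have hlen : ∀ q, ((tw len q).map (sub σ)).length = (val q).norm := by
    intro q; simp [tw, len, word, FreeGroup.norm]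
  have hback : ∀ q, FreeGroup.lift (fun b => (mk [ℓ b] : FreeGroup α))
      (mk ((tw len q).map (sub σ))) = val q := by
    intro q
    rw [lift_sub, List.map_map]
    have : (sub ℓ ∘ sub σ) = sub ℓ := by
      funext p
      rw [Function.comp, sub_sub]
      simp only [hσ1]
    rw [this, hℓ]
    exact FreeGroup.mk_toWord
  have hnn : ∀ q, val q ≠ 1 → (tw len q).map (sub σ) ≠ [] := by
    intro q hq h
    have := hlen q
    rw [h] at this
    exact hq (FreeGroup.norm_eq_zero.1 this.symm)
  have hSolv : Solv g ((List.ofFn U ++ [V]).map mk : List (FreeGroup (Tag g k × ℕ))) := by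
    let f : Tag g k → FreeGroup (Tag g k × ℕ) := fun q => mk ((tw len q).map (sub σ))
    refine ⟨((List.ofFn fun i => (f (tx i))⁻¹)).reverse, by simp, ?_⟩
    have e1 : ((List.ofFn U ++ [V]).map mk : List (FreeGroup (Tag g k × ℕ))) =
        List.ofFn (fun j => f (tc j)) ++ [f t0] := by
      rw [List.map_append, List.map_ofFn]; rfl
    rw [e1]
    have e2 := CP.ofFn (fun j => f (tc j)) (fun j => f (tz j)) (f t0)
    rw [mul_assoc] at hσ2
    have e3 := eq_inv_of_mul_eq_one_right hσ2
    have e4 : ((List.ofFn fun i => (f (tx i))⁻¹).reverse.map fun a => a ^ 2).prod =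
        ((List.ofFn fun i => f (tx i) ^ 2).prod)⁻¹ := by
      rw [List.prod_inv_reverse, List.map_reverse, List.map_ofFn, List.map_ofFn]
      congr 3
      funext i
      simp [Function.comp]
    rw [e4]
    convert e2 using 1
    exact e3.symm
  obtain ⟨w, e, hw, he, heq⟩ := main_beta hg U V (fun j => hnn _ (hCj j)) (hnn _ hC) hσ3 hSolv s (by
    rw [List.flatten_append, List.length_append, length_flatten_ofFn, hs]
    simp only [U, hlen]
    simp only [List.flatten_cons, List.flatten_nil, List.append_nil, V, hlen]
    rfl)
  let ρ := FreeGroup.lift (fun b => (mk [ℓ b] : FreeGroup α))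
  refine ⟨fun j => ρ (w j), fun i => ρ (e i), fun j => (norm_lift_sub ℓ _).trans (hw j),
    fun i => (norm_lift_sub ℓ _).trans (he i), ?_⟩
  have := congrArg ρ heq
  simp only [map_mul, map_list_prod, List.map_ofFn] at this
  have hV : ρ (mk V) = C := hback t0
  have hUj : ∀ j, ρ (mk (U j)) = Cj j := fun j => hback (tc j)
  rw [hV] at this
  simpa only [Function.comp_def, map_mul, map_inv, map_pow, hUj] using this

end QE

/-- **Theorem 2 (non-orientable case), equation form.** If the standard non-orientable
quadratic equation `(∏ᵢ xᵢ²) (∏ⱼ zⱼ⁻¹ Cⱼ zⱼ) C = 1` with nontrivial cyclically reduced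
coefficients has a solution in a free group, then there are conjugators `wⱼ` with
`|wⱼ| ≤ 12 s⁴` and elements `eᵢ` with `|eᵢ| ≤ 12 s⁴` such that
`(∏ⱼ wⱼ⁻¹ Cⱼ wⱼ) C = e₁² ⋯ e_g²`, where `s` is the total length of the coefficients. -/
theorem stmt_14 {α : Type*} [DecidableEq α] (g m : ℕ) (hg : 1 ≤ g) (hm : 1 ≤ m)
    (Cj : Fin (m - 1) → FreeGroup α) (C : FreeGroup α)
    (hCj : ∀ j, Cj j ≠ 1 ∧ CyclicallyReduced (Cj j))
    (hC : C ≠ 1) (hCred : CyclicallyReduced C)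
    (s : ℕ) (hs : s = (∑ j, (Cj j).norm) + C.norm)
    (x : Fin g → FreeGroup α) (z : Fin (m - 1) → FreeGroup α)
    (hsol : (List.ofFn fun i => x i ^ 2).prod *
        (List.ofFn fun j => (z j)⁻¹ * Cj j * z j).prod * C = 1) :
    ∃ w : Fin (m - 1) → FreeGroup α, ∃ e : Fin g → FreeGroup α,
      (∀ j, (w j).norm ≤ 12 * s ^ 4) ∧
      (∀ i, (e i).norm ≤ 12 * s ^ 4) ∧
      (List.ofFn fun j => (w j)⁻¹ * Cj j * w j).prod * C =
        (List.ofFn fun i => e i ^ 2).prod := by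
  exact QE.main_thm g (m - 1) hg Cj C (fun j => (hCj j).1) hC s hs x z hsol
end

section
/- Let F be a free group and for w ∈ F let |w| denote the length of the reduced word representing w. Suppose C ∈ F is nontrivial and is a product of g commutators in F for some g ≥ 1 (not necessarily minimal). Then there exist a_1,b_1,…,a_g,b_g ∈ F with C = [a_1,b_1]·…·[a_g,b_g] and |a_i| < 2|C|, |b_i| < 2|C| for all i = 1,…,g. -/
namespace Stmt15

/-- flip the sign of a letter -/
def fl {E : Type*} (l : E × Bool) : E × Bool := (l.1, !l.2)

@[simp] theorem fl_fl {E : Type*} (l : E × Bool) : fl (fl l) = l := by simp [fl]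

theorem fl_ne {E : Type*} (l : E × Bool) : fl l ≠ l := by
  rcases l with ⟨e, b⟩; cases b <;> simp [fl]

/-- orientable quadratic words -/
def Quad {E : Type*} (Q : List (E × Bool)) : Prop := Q.Nodup ∧ ∀ l ∈ Q, fl l ∈ Q

def cm {G : Type*} [Group G] (a b : G) : G := a⁻¹ * b⁻¹ * a * b

/-- products of `g` commutators -/
def IsProd {G : Type*} [Group G] (g : ℕ) (c : G) : Prop :=
  ∃ L : List (G × G), L.length = g ∧ c = (L.map fun p => cm p.1 p.2).prod

theorem IsProd.map {G H : Type*} [Group G] [Group H] (f : G →* H) {g : ℕ} {c : G}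
    (h : IsProd g c) : IsProd g (f c) := by
  obtain ⟨L, hL, rfl⟩ := h
  refine ⟨L.map fun p => (f p.1, f p.2), by simpa using hL, ?_⟩
  rw [map_list_prod, List.map_map, List.map_map]
  congr 1
  apply List.map_congr_left
  intro p _
  simp [cm]

/-- extend a map on generators to signed letters -/
def ext {E A : Type*} (φ : E → A × Bool) (l : E × Bool) : A × Bool :=
  ((φ l.1).1, (φ l.1).2 == l.2)

theorem ext_fl {E A : Type*} (φ : E → A × Bool) (l : E × Bool) :
    ext φ (fl l) = fl (ext φ l) := by
  rcases l with ⟨e, b⟩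
  simp only [ext, fl]
  rcases h : φ e with ⟨x, c⟩
  cases b <;> cases c <;> simp

def hm {E A : Type*} (φ : E → A × Bool) : FreeGroup E →* FreeGroup A :=
  FreeGroup.lift fun e => FreeGroup.mk [φ e]

theorem mk_cons {A : Type*} (l : A × Bool) (L : List (A × Bool)) :
    FreeGroup.mk (l :: L) = FreeGroup.mk [l] * FreeGroup.mk L := by
  simp [FreeGroup.mul_mk]

theorem mk_fl {A : Type*} (l : A × Bool) :
    FreeGroup.mk [fl l] = (FreeGroup.mk [l])⁻¹ := by
  simp [FreeGroup.inv_mk, FreeGroup.invRev, fl]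

theorem hm_mk {E A : Type*} (φ : E → A × Bool) (L : List (E × Bool)) :
    hm φ (FreeGroup.mk L) = FreeGroup.mk (L.map (ext φ)) := by
  induction L with
  | nil => simp [← FreeGroup.one_eq_mk]
  | cons l L ih =>
    rw [mk_cons, map_mul, ih, List.map_cons, mk_cons (ext φ l)]
    congr 1
    rcases l with ⟨e, b⟩
    cases b
    · have : ext φ (e, false) = fl (φ e) := by
        simp only [ext, fl]; rcases φ e with ⟨x, c⟩; cases c <;> simp
      rw [this, mk_fl]
      simp [hm]
    · have : ext φ (e, true) = φ e := by
        simp only [ext]; rcases φ e with ⟨x, c⟩; cases c <;> simp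
      rw [this]
      simp [hm]

theorem norm_hm {E A : Type*} [DecidableEq E] [DecidableEq A] (φ : E → A × Bool)
    (x : FreeGroup E) : (hm φ x).norm ≤ x.norm := by
  conv_lhs => rw [← FreeGroup.mk_toWord (x := x)]
  rw [hm_mk]
  refine FreeGroup.norm_mk_le.trans ?_
  simp [FreeGroup.norm]

/-! ### Deleting a cancelling pair -/

/-- `w` is the image of a quadratic word over `E` of genus at most `g`. -/
def Rep {A : Type*} (E : Type) (g : ℕ) (w : List (A × Bool)) : Prop :=
  ∃ (Q : List (E × Bool)) (φ : E → A × Bool), Quad Q ∧ Q.map (ext φ) = w ∧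
    IsProd g (FreeGroup.mk Q)

theorem quad_delete {E : Type*} {P R : List (E × Bool)} {s : E × Bool}
    (h : Quad (P ++ s :: fl s :: R)) : Quad (P ++ R) := by
  obtain ⟨h1, h2⟩ := h
  have hp : (P ++ s :: fl s :: R).Perm (s :: fl s :: (P ++ R)) :=
    List.perm_middle.trans (List.Perm.cons _ List.perm_middle)
  have hn := hp.nodup_iff.1 h1
  simp only [List.nodup_cons, List.mem_cons, not_or] at hn
  refine ⟨hn.2.2, fun l hl => ?_⟩
  have h3 := hp.mem_iff.1 (h2 l (hp.mem_iff.2 (by simp only [List.mem_cons]; tauto)))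
  simp only [List.mem_cons] at h3
  rcases h3 with h3 | h3 | h3
  · exfalso; apply hn.2.1; rw [← h3, fl_fl]; exact hl
  · exfalso; apply hn.1.2
    have := congrArg fl h3
    rw [fl_fl, fl_fl] at this
    rw [← this]; exact hl
  · exact h3

theorem rep_step {A : Type*} {E : Type} [DecidableEq E] {g : ℕ} {w w' : List (A × Bool)}
    (hs : FreeGroup.Red.Step w w') (h : Rep E g w) : Rep E g w' := by
  obtain ⟨Q, φ, hQ, hw, hK⟩ := h
  cases hs with
  | @not L1 L2 x b =>
  obtain ⟨P, Q2, rfl, hP, hQ2⟩ := List.map_eq_append_iff.1 hw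
  obtain ⟨s, Q3, rfl, hs, hQ3⟩ := List.map_eq_cons_iff.1 hQ2
  obtain ⟨t, R, rfl, ht, hR⟩ := List.map_eq_cons_iff.1 hQ3
  have hst : ext φ t = fl (ext φ s) := by rw [hs, ht]; rfl
  have hne : s ≠ t := by
    rintro rfl
    exact fl_ne _ hst.symm
  by_cases htf : t = fl s
  · subst htf
    refine ⟨P ++ R, φ, quad_delete hQ, by simp [hP, hR], ?_⟩
    have : FreeGroup.mk (P ++ s :: fl s :: R) = FreeGroup.mk (P ++ R) := by
      apply Quot.sound
      rcases s with ⟨e, c⟩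
      exact FreeGroup.Red.Step.not
    rwa [this] at hK
  · have hee : s.1 ≠ t.1 := by
      intro he
      rcases s with ⟨e, c⟩
      rcases t with ⟨e', c'⟩
      simp only at he
      subst he
      cases c <;> cases c' <;> simp_all [fl]
    let ψ : E → E × Bool := fun e => if e = t.1 then (s.1, (!s.2) == t.2) else (e, true)
    have ψo : ∀ l : E × Bool, l.1 ≠ t.1 → ext ψ l = l := by
      intro l hl; simp [ext, ψ, hl]
    have ψt : ext ψ t = fl s := by
      simp only [ext, ψ, fl, if_true]
      rcases s with ⟨e, c⟩
      rcases t with ⟨e', c'⟩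
      cases c <;> cases c' <;> simp
    have ψs : ext ψ s = s := ψo s hee
    have ψft : ext ψ (fl t) = s := by rw [ext_fl, ψt, fl_fl]
    have ψfs : ext ψ (fl s) = fl s := by rw [ext_fl, ψs]
    have cl : ∀ l : E × Bool, l = t ∨ l = fl t ∨ l.1 ≠ t.1 := by
      rintro ⟨e, c⟩
      rcases t with ⟨e', c'⟩
      by_cases h : e = e'
      · subst h; cases c <;> cases c' <;> simp [fl]
      · simp [h]
    have hφψ : ∀ l, ext φ (ext ψ l) = ext φ l := by
      intro l
      rcases cl l with rfl | rfl | h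
      · rw [ψt, ext_fl, hst]
      · rw [ψft, ext_fl, hst, fl_fl]
      · rw [ψo l h]
    obtain ⟨h1, h2⟩ := hQ
    have hp : (P ++ s :: t :: R).Perm (s :: t :: (P ++ R)) :=
      List.perm_middle.trans (List.Perm.cons _ List.perm_middle)
    have hn := hp.nodup_iff.1 h1
    simp only [List.nodup_cons, List.mem_cons, not_or] at hn
    obtain ⟨⟨-, hsn⟩, htn, hnd⟩ := hn
    have hmem : ∀ l, l ∈ P ++ R → fl l = s ∨ fl l = t ∨ fl l ∈ P ++ R := by
      intro l hl
      have h3 := hp.mem_iff.1 (h2 l (hp.mem_iff.2 (by simp only [List.mem_cons]; tauto)))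
      simpa only [List.mem_cons] using h3
    have hfs : fl s ∈ P ++ R := by
      have h3 := hp.mem_iff.1 (h2 s (hp.mem_iff.2 (by simp)))
      simp only [List.mem_cons] at h3
      rcases h3 with h3 | h3 | h3
      · exact absurd h3 (fl_ne s)
      · exact absurd h3.symm htf
      · exact h3
    have hft : fl t ∈ P ++ R := by
      have h3 := hp.mem_iff.1 (h2 t (hp.mem_iff.2 (by simp)))
      simp only [List.mem_cons] at h3
      rcases h3 with h3 | h3 | h3
      · exact absurd (by rw [← h3, fl_fl]) htf
      · exact absurd h3 (fl_ne t)
      · exact h3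
    refine ⟨(P ++ R).map (ext ψ), φ, ⟨?_, ?_⟩, ?_, ?_⟩
    · refine hnd.map_on ?_
      intro l hl m hm hlm
      rcases cl l with rfl | rfl | h
      · exact absurd hl htn
      · rcases cl m with rfl | rfl | h'
        · exact absurd hm htn
        · rfl
        · rw [ψft, ψo m h'] at hlm
          subst hlm; exact absurd hm hsn
      · rcases cl m with rfl | rfl | h'
        · exact absurd hm htn
        · rw [ψft, ψo l h] at hlm
          subst hlm; exact absurd hl hsn
        · rwa [ψo l h, ψo m h'] at hlm
    · intro l hl
      obtain ⟨m, hm, rfl⟩ := List.mem_map.1 hl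
      rw [← ext_fl]
      rcases hmem m hm with h | h | h
      · rw [h, ψs, ← ψft]; exact List.mem_map_of_mem hft
      · rw [h, ψt, ← ψfs]; exact List.mem_map_of_mem hfs
      · exact List.mem_map_of_mem h
    · rw [List.map_map, ← hP, ← hR, ← List.map_append]
      apply List.map_congr_left
      intro l _
      exact hφψ l
    · have h4 := hK.map (hm ψ)
      rw [hm_mk, List.map_append, List.map_cons, List.map_cons, ψs, ψt] at h4
      have : FreeGroup.mk (P.map (ext ψ) ++ s :: fl s :: R.map (ext ψ))
          = FreeGroup.mk ((P ++ R).map (ext ψ)) := by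
        rw [List.map_append]
        apply Quot.sound
        rcases s with ⟨e, c⟩
        exact FreeGroup.Red.Step.not
      rwa [this] at h4

theorem rep_red {A : Type*} {E : Type} [DecidableEq E] {g : ℕ} {w w' : List (A × Bool)}
    (hs : FreeGroup.Red w w') (h : Rep E g w) : Rep E g w' := by
  induction hs with
  | refl => exact h
  | tail _ hs ih => exact rep_step hs ih

/-! ### Existence -/

theorem map_invRev {E A : Type*} (φ : E → A × Bool) (L : List (E × Bool)) :
    (FreeGroup.invRev L).map (ext φ) = FreeGroup.invRev (L.map (ext φ)) := by
  simp only [FreeGroup.invRev, List.map_reverse, List.map_map]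
  congr 1
  apply List.map_congr_left
  intro l _
  exact ext_fl φ l

theorem rep_exists {A : Type*} (g : ℕ) (c : FreeGroup A) (h : IsProd g c) :
    ∃ (E : Type) (_ : Fintype E) (_ : DecidableEq E) (w : List (A × Bool)),
      FreeGroup.mk w = c ∧ Rep E g w := by
  obtain ⟨L, hL, rfl⟩ := h
  induction L generalizing g with
  | nil =>
    refine ⟨Empty, inferInstance, inferInstance, [], by simp [FreeGroup.one_eq_mk], [],
      fun e => e.elim, ⟨by simp, by simp⟩, rfl, [], by simpa using hL, ?_⟩
    simp [FreeGroup.one_eq_mk]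
  | cons p L ih =>
    obtain ⟨E, _, _, w, hw, Q, φ, hQ, hQw, M, hM, hMQ⟩ := ih L.length rfl
    obtain ⟨u, hu⟩ := Quot.exists_rep p.1
    obtain ⟨v, hv⟩ := Quot.exists_rep p.2
    let X : List ((E ⊕ (Fin u.length ⊕ Fin v.length)) × Bool) :=
      List.ofFn fun k => (Sum.inr (Sum.inl k), true)
    let Y : List ((E ⊕ (Fin u.length ⊕ Fin v.length)) × Bool) :=
      List.ofFn fun k => (Sum.inr (Sum.inr k), true)
    let φ' : E ⊕ (Fin u.length ⊕ Fin v.length) → A × Bool :=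
      Sum.elim φ (Sum.elim (fun k => u.get k) (fun k => v.get k))
    let ι : E → (E ⊕ (Fin u.length ⊕ Fin v.length)) × Bool := fun e => (Sum.inl e, true)
    have hX : X.map (ext φ') = u := by
      simp only [X, List.map_ofFn]
      conv_rhs => rw [← List.ofFn_get u]
      congr 1
      funext k
      simp [ext, φ']
    have hY : Y.map (ext φ') = v := by
      simp only [Y, List.map_ofFn]
      conv_rhs => rw [← List.ofFn_get v]
      congr 1
      funext k
      simp [ext, φ']
    have hι : ∀ l, ext ι l = (Sum.inl l.1, l.2) := by
      intro l; simp [ext, ι]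
    have hQ' : (Q.map (ext ι)).map (ext φ') = w := by
      rw [List.map_map, ← hQw]
      apply List.map_congr_left
      intro l _
      simp [ext, ι, φ']
    have hXn : X.Nodup := by
      apply List.nodup_ofFn.2
      intro a b hab
      simpa using hab
    have hYn : Y.Nodup := by
      apply List.nodup_ofFn.2
      intro a b hab
      simpa using hab
    have invn : ∀ Z : List ((E ⊕ (Fin u.length ⊕ Fin v.length)) × Bool), Z.Nodup →
        (FreeGroup.invRev Z).Nodup := by
      intro Z hZ
      rw [FreeGroup.invRev, List.nodup_reverse]
      refine hZ.map ?_
      rintro ⟨a, b⟩ ⟨a', b'⟩ h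
      simpa using h
    have minv : ∀ (Z : List ((E ⊕ (Fin u.length ⊕ Fin v.length)) × Bool)) l,
        l ∈ FreeGroup.invRev Z ↔ fl l ∈ Z := by
      intro Z l
      simp only [FreeGroup.invRev, List.mem_reverse, List.mem_map]
      constructor
      · rintro ⟨m, hm, rfl⟩
        simpa [fl] using hm
      · intro h
        exact ⟨fl l, h, by simp [fl]⟩
    have mX : ∀ l, l ∈ X ↔ ∃ k, (Sum.inr (Sum.inl k), true) = l := by
      intro l; simp only [X, List.mem_ofFn]
    have mY : ∀ l, l ∈ Y ↔ ∃ k, (Sum.inr (Sum.inr k), true) = l := by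
      intro l; simp only [Y, List.mem_ofFn]
    refine ⟨E ⊕ (Fin u.length ⊕ Fin v.length), inferInstance, inferInstance,
      FreeGroup.invRev u ++ (FreeGroup.invRev v ++ (u ++ (v ++ w))), ?_,
      FreeGroup.invRev X ++ (FreeGroup.invRev Y ++ (X ++ (Y ++ Q.map (ext ι)))), φ',
      ⟨?_, ?_⟩, ?_, ?_⟩
    · rw [← FreeGroup.mul_mk, ← FreeGroup.mul_mk, ← FreeGroup.mul_mk, ← FreeGroup.mul_mk,
        ← FreeGroup.inv_mk, ← FreeGroup.inv_mk, hw, List.map_cons, List.prod_cons, cm,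
        ← hu, ← hv]
      simp only [FreeGroup.quot_mk_eq_mk, mul_assoc]
    · have hQn : (Q.map (ext ι)).Nodup := by
        refine hQ.1.map ?_
        rintro ⟨a, b⟩ ⟨a', b'⟩ h
        simpa [hι] using h
      rw [List.nodup_append', List.nodup_append', List.nodup_append', List.nodup_append']
      refine ⟨invn _ hXn, ⟨invn _ hYn, ⟨hXn, ⟨hYn, hQn, ?_⟩, ?_⟩, ?_⟩, ?_⟩
      all_goals
        intro l h1 h2
        simp only [List.mem_append, minv, mX, mY, List.mem_map, hι] at h1 h2
        rcases l with ⟨e, b⟩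
        simp only [fl, Prod.mk.injEq] at h1 h2
        grind
    · intro l hl
      simp only [List.mem_append, minv, fl_fl] at hl ⊢
      have : l ∈ Q.map (ext ι) → fl l ∈ Q.map (ext ι) := by
        intro h
        obtain ⟨m, hm, rfl⟩ := List.mem_map.1 h
        rw [← ext_fl]
        exact List.mem_map_of_mem (hQ.2 m hm)
      tauto
    · simp only [List.map_append, map_invRev, hX, hY, hQ']
    · refine ⟨(FreeGroup.mk X, FreeGroup.mk Y) :: M.map fun p => (hm ι p.1, hm ι p.2), ?_, ?_⟩
      · simpa [hM] using hL
      · rw [← FreeGroup.mul_mk, ← FreeGroup.mul_mk, ← FreeGroup.mul_mk, ← FreeGroup.mul_mk,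
          ← FreeGroup.inv_mk, ← FreeGroup.inv_mk, List.map_cons, List.prod_cons, cm,
          ← hm_mk, hMQ, map_list_prod, List.map_map, List.map_map]
        simp only [mul_assoc]
        congr 6
        funext p
        simp [cm]

/-! ### Linked pairs -/

theorem linked {E : Type*} [DecidableEq E] (n : ℕ) (Q : List (E × Bool)) (hn : Q.length ≤ n)
    (hQ : Quad Q) :
    FreeGroup.mk Q = 1 ∨ ∃ A B C D F x y,
      Q = A ++ x :: (B ++ y :: (C ++ fl x :: (D ++ fl y :: F))) := by
  induction n generalizing Q with
  | zero =>
    left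
    have : Q = [] := by simpa using hn
    subst this; rfl
  | succ n ih =>
    rcases Q with _ | ⟨x, Q⟩
    · left; rfl
    have hx : fl x ∈ Q := by
      have := hQ.2 x (by simp)
      simp only [List.mem_cons] at this
      exact this.resolve_left (fl_ne x)
    obtain ⟨B, D, rfl⟩ := List.append_of_mem hx
    obtain ⟨h1, h2⟩ := hQ
    by_cases hB : ∀ l ∈ B, fl l ∈ B
    · have hBq : Quad B := by
        refine ⟨?_, hB⟩
        exact (List.nodup_append'.1 (List.nodup_cons.1 h1).2).1
      have hDq : Quad D := by
        refine ⟨(List.nodup_cons.1 (List.nodup_append'.1 (List.nodup_cons.1 h1).2).2.1).2, ?_⟩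
        intro l hl
        have h3 := h2 l (by simp [hl])
        simp only [List.mem_cons, List.mem_append] at h3
        simp only [List.nodup_cons, List.nodup_append', List.mem_append, List.mem_cons,
          List.disjoint_cons_right, not_or] at h1
        rcases h3 with h3 | h3 | h3 | h3
        · exfalso; apply h1.2.2.1.1; rw [← h3, fl_fl]; exact hl
        · exfalso
          have := hB _ h3
          rw [fl_fl] at this
          exact h1.2.2.2.2 this hl
        · exfalso
          have := congrArg fl h3
          rw [fl_fl, fl_fl] at this
          subst this
          exact h1.1.2.2 hl
        · exact h3
      simp only [List.length_cons, List.length_append] at hn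
      rcases ih B (by omega) hBq with hb | ⟨A, B1, C, D1, F, z, y, rfl⟩
      · rcases ih D (by omega) hDq with hd | ⟨A, B1, C, D1, F, z, y, rfl⟩
        · left
          rw [mk_cons, ← FreeGroup.mul_mk, mk_cons (fl x), hb, hd, mk_fl, one_mul, mul_one,
            mul_inv_cancel]
        · right
          exact ⟨x :: (B ++ fl x :: A), B1, C, D1, F, z, y, by simp⟩
      · right
        exact ⟨x :: A, B1, C, D1, F ++ fl x :: D, z, y, by simp⟩
    · push Not at hB
      obtain ⟨y, hy, hyB⟩ := hB
      right
      have hyD : fl y ∈ D := by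
        have h3 := h2 y (by simp [hy])
        simp only [List.mem_cons, List.mem_append] at h3
        simp only [List.nodup_cons, List.nodup_append', List.mem_append, List.mem_cons,
          List.disjoint_cons_right, not_or] at h1
        rcases h3 with h3 | h3 | h3 | h3
        · exfalso; apply h1.2.2.2.1; rw [← h3, fl_fl]; exact hy
        · exact absurd h3 hyB
        · exfalso
          have := congrArg fl h3
          rw [fl_fl, fl_fl] at this
          subst this
          exact h1.1.1 hy
        · exact h3
      obtain ⟨B1, C, rfl⟩ := List.append_of_mem hy
      obtain ⟨D1, F, rfl⟩ := List.append_of_mem hyD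
      exact ⟨[], B1, C, D1, F, x, y, by simp⟩

/-! ### The truncated Magnus expansion -/

structure Mag (E : Type) where
  u : E → ℚ
  β : Matrix E E ℚ

theorem Mag.ext' {E : Type} {a b : Mag E} (h1 : a.u = b.u) (h2 : a.β = b.β) : a = b := by
  cases a; cases b; simp_all

instance (E : Type) : Mul (Mag E) := ⟨fun a b => ⟨a.u + b.u, a.β + b.β + Matrix.vecMulVec a.u b.u⟩⟩
instance (E : Type) : One (Mag E) := ⟨⟨0, 0⟩⟩
instance (E : Type) : Inv (Mag E) := ⟨fun a => ⟨-a.u, -a.β + Matrix.vecMulVec a.u a.u⟩⟩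

@[simp] theorem Mag.mul_u {E : Type} (a b : Mag E) : (a * b).u = a.u + b.u := rfl
@[simp] theorem Mag.mul_β {E : Type} (a b : Mag E) :
    (a * b).β = a.β + b.β + Matrix.vecMulVec a.u b.u := rfl
@[simp] theorem Mag.one_u {E : Type} : (1 : Mag E).u = 0 := rfl
@[simp] theorem Mag.one_β {E : Type} : (1 : Mag E).β = 0 := rfl
@[simp] theorem Mag.inv_u {E : Type} (a : Mag E) : (a⁻¹).u = -a.u := rfl
@[simp] theorem Mag.inv_β {E : Type} (a : Mag E) :
    (a⁻¹).β = -a.β + Matrix.vecMulVec a.u a.u := rfl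

instance (E : Type) : Group (Mag E) := Group.ofLeftAxioms
  (by
    intro a b c
    apply Mag.ext'
    · simp [add_assoc]
    · ext i j; simp [Matrix.vecMulVec_apply]; ring)
  (by
    intro a
    apply Mag.ext'
    · simp
    · ext i j; simp [Matrix.vecMulVec_apply])
  (by
    intro a
    apply Mag.ext'
    · simp
    · ext i j; simp [Matrix.vecMulVec_apply])

theorem cm_u {E : Type} (a b : Mag E) : (cm a b).u = 0 := by
  simp [cm]

theorem cm_β {E : Type} (a b : Mag E) :
    (cm a b).β = Matrix.vecMulVec a.u b.u - Matrix.vecMulVec b.u a.u := by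
  ext i j; simp [cm, Matrix.vecMulVec_apply]; ring

variable {E : Type}

theorem rank_add_le' [Fintype E] (M N : Matrix E E ℚ) : (M + N).rank ≤ M.rank + N.rank := by
  classical
  have h : LinearMap.range (M + N).mulVecLin ≤
      LinearMap.range M.mulVecLin ⊔ LinearMap.range N.mulVecLin := by
    rintro _ ⟨f, rfl⟩
    rw [Matrix.mulVecLin_add]
    exact Submodule.add_mem_sup ⟨f, rfl⟩ ⟨f, rfl⟩
  exact (Submodule.finrank_mono h).trans (Submodule.finrank_add_le_finrank_add_finrank _ _)

theorem isProd_rank [Fintype E] {g : ℕ} {c : Mag E} (h : IsProd g c) : c.β.rank ≤ 2 * g := by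
  obtain ⟨L, hL, rfl⟩ := h
  induction L generalizing g with
  | nil => simp
  | cons p L ih =>
    subst hL
    have := ih rfl
    rw [List.map_cons, List.prod_cons, Mag.mul_β, cm_u, cm_β, Matrix.zero_vecMulVec, add_zero]
    refine (rank_add_le' _ _).trans ?_
    have h1 : (Matrix.vecMulVec p.1.u p.2.u - Matrix.vecMulVec p.2.u p.1.u).rank ≤ 2 := by
      rw [sub_eq_add_neg, ← Matrix.neg_vecMulVec]
      refine (rank_add_le' _ _).trans ?_
      have a1 := Matrix.rank_vecMulVec_le p.1.u p.2.u
      have a2 := Matrix.rank_vecMulVec_le (-p.2.u) p.1.u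
      omega
    simp only [List.length_cons]
    omega

theorem rank_drop [Fintype E] [DecidableEq E] (u v : E → ℚ) (B : Matrix E E ℚ) (x y : E)
    (hux : u x ≠ 0) (huy : u y = 0) (hvx : v x = 0) (hvy : v y ≠ 0)
    (hBx : ∀ i, B i x = 0) (hBy : ∀ i, B i y = 0) (hxB : ∀ i, B x i = 0) (hyB : ∀ i, B y i = 0) :
    B.rank + 2 ≤ (Matrix.vecMulVec u v - Matrix.vecMulVec v u + B).rank := by
  set M := Matrix.vecMulVec u v - Matrix.vecMulVec v u + B with hM
  have hMf : ∀ f, M.mulVec f = (v ⬝ᵥ f) • u - (u ⬝ᵥ f) • v + B.mulVec f := by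
    intro f
    rw [hM, Matrix.add_mulVec, Matrix.sub_mulVec, Matrix.vecMulVec_mulVec,
      Matrix.vecMulVec_mulVec]
    simp
  have hu : u ∈ LinearMap.range M.mulVecLin := by
    refine ⟨(v y)⁻¹ • Pi.single y 1, ?_⟩
    rw [map_smul, Matrix.mulVecLin_apply, hMf]
    have : B.mulVec (Pi.single y 1) = 0 := by
      ext i; simp [hBy]
    rw [this]
    simp [huy, smul_smul, hvy]
  have hv : v ∈ LinearMap.range M.mulVecLin := by
    refine ⟨-(u x)⁻¹ • Pi.single x 1, ?_⟩
    rw [map_smul, Matrix.mulVecLin_apply, hMf]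
    have : B.mulVec (Pi.single x 1) = 0 := by
      ext i; simp [hBx]
    rw [this]
    simp [hvx, smul_smul, hux]
  have hB : ∀ b ∈ LinearMap.range B.mulVecLin, b ∈ LinearMap.range M.mulVecLin := by
    rintro _ ⟨f, rfl⟩
    have : B.mulVecLin f = M.mulVecLin f - (v ⬝ᵥ f) • u + (u ⬝ᵥ f) • v := by
      simp only [Matrix.mulVecLin_apply, hMf]; abel
    rw [this]
    exact add_mem (sub_mem ⟨f, rfl⟩ (Submodule.smul_mem _ _ hu)) (Submodule.smul_mem _ _ hv)
  let T : (LinearMap.range B.mulVecLin × (ℚ × ℚ)) →ₗ[ℚ] (E → ℚ) :=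
    LinearMap.coprod (Submodule.subtype _)
      (LinearMap.coprod (LinearMap.toSpanSingleton ℚ _ u) (LinearMap.toSpanSingleton ℚ _ v))
  have hT : ∀ z, T z ∈ LinearMap.range M.mulVecLin := by
    rintro ⟨⟨b, hb⟩, s, t⟩
    simp only [T, LinearMap.coprod_apply, LinearMap.toSpanSingleton_apply, Submodule.subtype_apply]
    exact add_mem (hB b hb) (add_mem (Submodule.smul_mem _ _ hu) (Submodule.smul_mem _ _ hv))
  have hinj : Function.Injective (T.codRestrict _ hT) := by
    rw [← LinearMap.ker_eq_bot, LinearMap.ker_codRestrict, LinearMap.ker_eq_bot']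
    rintro ⟨⟨b, hb⟩, s, t⟩ h0
    simp only [T, LinearMap.coprod_apply, LinearMap.toSpanSingleton_apply,
      Submodule.subtype_apply] at h0
    have hbx : b x = 0 := by
      obtain ⟨f, rfl⟩ := hb
      simp [Matrix.mulVec, dotProduct, hxB]
    have hby : b y = 0 := by
      obtain ⟨f, rfl⟩ := hb
      simp [Matrix.mulVec, dotProduct, hyB]
    have e1 := congrFun h0 x
    have e2 := congrFun h0 y
    simp [hbx, hvx, hux] at e1
    simp [hby, huy, hvy] at e2
    subst e1 e2
    simp at h0
    subst h0
    rfl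
  have := LinearMap.finrank_le_finrank_of_injective hinj
  simpa [Matrix.rank] using this

/-- The Magnus homomorphism. -/
noncomputable def mag [DecidableEq E] : FreeGroup E →* Mag E :=
  FreeGroup.lift fun e => ⟨Pi.single e 1, 0⟩

theorem mag_letter_u [DecidableEq E] (l : E × Bool) (e : E) (h : l.1 ≠ e) :
    (mag (FreeGroup.mk [l])).u e = 0 := by
  rcases l with ⟨a, b⟩
  have h' : e ≠ a := fun h1 => h h1.symm
  cases b <;> simp [mag, h']

theorem mag_letter_self [DecidableEq E] (l : E × Bool) :
    (mag (FreeGroup.mk [l])).u l.1 ≠ 0 := by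
  rcases l with ⟨a, b⟩
  cases b <;> simp [mag]

theorem mag_avoid [DecidableEq E] (L : List (E × Bool)) (e : E) (h : ∀ l ∈ L, l.1 ≠ e) :
    (mag (FreeGroup.mk L)).u e = 0 ∧ (∀ i, (mag (FreeGroup.mk L)).β i e = 0) ∧
      (∀ i, (mag (FreeGroup.mk L)).β e i = 0) := by
  induction L with
  | nil =>
    rw [← FreeGroup.one_eq_mk]
    simp
  | cons l L ih =>
    obtain ⟨i1, i2, i3⟩ := ih fun m hm => h m (by simp [hm])
    have hl := h l (by simp)
    rw [mk_cons, map_mul]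
    have a1 := mag_letter_u l e hl
    have a2 : (∀ i, (mag (FreeGroup.mk [l])).β i e = 0) ∧
        ∀ i, (mag (FreeGroup.mk [l])).β e i = 0 := by
      rcases l with ⟨a, b⟩
      have h' : e ≠ a := fun h1 => hl h1.symm
      cases b <;> simp [mag, h', Matrix.vecMulVec_apply]
    refine ⟨by simp [a1, i1], fun i => ?_, fun i => ?_⟩
    · simp [a2.1, i2, i1, Matrix.vecMulVec_apply]
    · simp [a2.2, i3, a1, Matrix.vecMulVec_apply]

/-! ### Extracting handles -/

theorem norm_conj_lt [DecidableEq E] (u v : List (E × Bool)) (n : ℕ) (hn : 1 ≤ n)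
    (h : v ≠ [] → 2 * u.length + v.length < 2 * n) :
    (FreeGroup.mk u * FreeGroup.mk v * (FreeGroup.mk u)⁻¹).norm < 2 * n := by
  by_cases hv : v = []
  · subst hv
    rw [← FreeGroup.one_eq_mk, mul_one, mul_inv_cancel, FreeGroup.norm_one]
    omega
  · have h1 := FreeGroup.norm_mul_le (FreeGroup.mk u * FreeGroup.mk v) (FreeGroup.mk u)⁻¹
    have h2 := FreeGroup.norm_mul_le (FreeGroup.mk u) (FreeGroup.mk v)
    rw [FreeGroup.norm_inv_eq] at h1
    have h3 : (FreeGroup.mk u).norm ≤ u.length := FreeGroup.norm_mk_le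
    have h4 : (FreeGroup.mk v).norm ≤ v.length := FreeGroup.norm_mk_le
    have := h hv
    omega

theorem handle [Fintype E] [DecidableEq E] (n : ℕ) (hn : 1 ≤ n)
    (A B C D F : List (E × Bool)) (x y : E × Bool)
    (hQ : Quad (A ++ x :: (B ++ y :: (C ++ fl x :: (D ++ fl y :: F)))))
    (hl : (A ++ x :: (B ++ y :: (C ++ fl x :: (D ++ fl y :: F)))).length ≤ n) :
    ∃ a b : FreeGroup E, a.norm < 2 * n ∧ b.norm < 2 * n ∧
      FreeGroup.mk (A ++ x :: (B ++ y :: (C ++ fl x :: (D ++ fl y :: F)))) =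
        cm a b * FreeGroup.mk (A ++ (D ++ (C ++ (B ++ F)))) ∧
      Quad (A ++ (D ++ (C ++ (B ++ F)))) ∧ (A ++ (D ++ (C ++ (B ++ F)))).length ≤ n ∧
      (mag (FreeGroup.mk (A ++ (D ++ (C ++ (B ++ F)))))).β.rank + 2 ≤
        (mag (FreeGroup.mk (A ++ x :: (B ++ y :: (C ++ fl x :: (D ++ fl y :: F)))))).β.rank := by
  set R := A ++ (D ++ (C ++ (B ++ F))) with hR
  have hp : (A ++ x :: (B ++ y :: (C ++ fl x :: (D ++ fl y :: F)))).Perm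
      (x :: y :: fl x :: fl y :: R) := by
    rw [List.perm_iff_count]
    intro l
    simp only [hR, List.count_append, List.count_cons]
    omega
  obtain ⟨h1, h2⟩ := hQ
  have hnd := hp.nodup_iff.1 h1
  simp only [List.nodup_cons, List.mem_cons, not_or] at hnd
  obtain ⟨⟨hxy, -, hxfy, hxR⟩, ⟨hyfx, -, hyR⟩, ⟨hfxy, hfxR⟩, hfyR, hRn⟩ := hnd
  have hRq : Quad R := by
    refine ⟨hRn, fun l hl => ?_⟩
    have h3 := hp.mem_iff.1 (h2 l (hp.mem_iff.2 (by simp only [List.mem_cons]; tauto)))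
    simp only [List.mem_cons] at h3
    have key : ∀ m, fl l = m → fl m ∉ R → False := by
      rintro m rfl h; rw [fl_fl] at h; exact h hl
    rcases h3 with h3 | h3 | h3 | h3 | h3
    · exact (key _ h3 hfxR).elim
    · exact (key _ h3 hfyR).elim
    · exact (key _ h3 (by rwa [fl_fl])).elim
    · exact (key _ h3 (by rwa [fl_fl])).elim
    · exact h3
  have same : ∀ l m : E × Bool, l.1 = m.1 → l = m ∨ l = fl m := by
    rintro ⟨e, c⟩ ⟨e', c'⟩ h
    simp only at h
    subst h; cases c <;> cases c' <;> simp [fl]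
  have hx1 : ∀ l ∈ R, l.1 ≠ x.1 := by
    intro l hl h
    rcases same _ _ h with rfl | rfl <;> contradiction
  have hy1 : ∀ l ∈ R, l.1 ≠ y.1 := by
    intro l hl h
    rcases same _ _ h with rfl | rfl <;> contradiction
  have hxy1 : x.1 ≠ y.1 := by
    intro h
    rcases same _ _ h with rfl | rfl <;> contradiction
  have av : ∀ (L : List (E × Bool)), L ⊆ R →
      (mag (FreeGroup.mk L)).u x.1 = 0 ∧ (mag (FreeGroup.mk L)).u y.1 = 0 := by
    intro L hL
    exact ⟨(mag_avoid L x.1 fun l hl => hx1 l (hL hl)).1,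
      (mag_avoid L y.1 fun l hl => hy1 l (hL hl)).1⟩
  have aB := av B (by intro l hl; simp [hR, hl])
  have aC := av C (by intro l hl; simp [hR, hl])
  have aD := av D (by intro l hl; simp [hR, hl])
  have xx := mag_letter_self x
  have yy := mag_letter_self y
  have xy := mag_letter_u x y.1 hxy1
  have yx := mag_letter_u y x.1 hxy1.symm
  have rx := mag_avoid R x.1 hx1
  have ry := mag_avoid R y.1 hy1
  have hlen := hp.length_eq
  simp only [List.length_append, List.length_cons] at hl
  let a : FreeGroup E := FreeGroup.mk A * FreeGroup.mk (D ++ (C ++ [fl x])) * (FreeGroup.mk A)⁻¹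
  let b : FreeGroup E := FreeGroup.mk (A ++ D) *
    FreeGroup.mk ([fl y] ++ (FreeGroup.invRev B ++ FreeGroup.invRev C)) * (FreeGroup.mk (A ++ D))⁻¹
  have ha : a = FreeGroup.mk A * (FreeGroup.mk D * (FreeGroup.mk C * (FreeGroup.mk [x])⁻¹)) *
      (FreeGroup.mk A)⁻¹ := by
    simp only [a, ← FreeGroup.mul_mk, mk_fl]
  have hb : b = FreeGroup.mk A * FreeGroup.mk D * ((FreeGroup.mk [y])⁻¹ *
      ((FreeGroup.mk B)⁻¹ * (FreeGroup.mk C)⁻¹)) * (FreeGroup.mk A * FreeGroup.mk D)⁻¹ := by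
    simp only [b, ← FreeGroup.mul_mk, mk_fl, ← FreeGroup.inv_mk]
  have hmul : FreeGroup.mk (A ++ x :: (B ++ y :: (C ++ fl x :: (D ++ fl y :: F)))) =
        cm a b * FreeGroup.mk R := by
    rw [ha, hb, hR]
    rw [← FreeGroup.mul_mk, mk_cons x, ← FreeGroup.mul_mk, mk_cons y, ← FreeGroup.mul_mk,
      mk_cons (fl x), ← FreeGroup.mul_mk, mk_cons (fl y), mk_fl, mk_fl]
    simp only [← FreeGroup.mul_mk, cm]
    group
  refine ⟨a, b, ?_, ?_, hmul, hRq, ?_, ?_⟩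
  · apply norm_conj_lt _ _ _ hn
    intro _
    simp only [List.length_append, List.length_cons, List.length_nil]
    omega
  · apply norm_conj_lt _ _ _ hn
    intro _
    simp only [List.length_append, List.length_cons, List.length_nil, FreeGroup.invRev_length]
    omega
  · simp only [hR, List.length_append]
    omega
  · rw [hmul, map_mul, Mag.mul_β]
    have e1 : mag (cm a b) = cm (mag a) (mag b) := by simp only [cm, map_mul, map_inv]
    have ua : (mag a).u = (mag (FreeGroup.mk D)).u + (mag (FreeGroup.mk C)).u
        - (mag (FreeGroup.mk [x])).u := by
      rw [ha]
      simp only [map_mul, map_inv, Mag.mul_u, Mag.inv_u]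
      abel
    have ub : (mag b).u = - (mag (FreeGroup.mk B)).u - (mag (FreeGroup.mk C)).u
        - (mag (FreeGroup.mk [y])).u := by
      rw [hb]
      simp only [map_mul, map_inv, Mag.mul_u, Mag.inv_u]
      abel
    rw [e1, cm_u, cm_β, Matrix.zero_vecMulVec, add_zero]
    apply rank_drop _ _ _ x.1 y.1 _ _ _ _ rx.2.1 ry.2.1 rx.2.2 ry.2.2
    · simpa [ua, aD.1, aC.1] using xx
    · simp [ua, aD.2, aC.2, xy]
    · simp [ub, aB.1, aC.1, yx]
    · simpa [ub, aB.2, aC.2] using yy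

theorem extract [Fintype E] [DecidableEq E] (n : ℕ) (hn : 1 ≤ n) (g : ℕ)
    (Q : List (E × Bool)) (hQ : Quad Q) (hl : Q.length ≤ n)
    (hr : (mag (FreeGroup.mk Q)).β.rank ≤ 2 * g) :
    ∃ L : List (FreeGroup E × FreeGroup E), L.length = g ∧
      FreeGroup.mk Q = (L.map fun p => cm p.1 p.2).prod ∧
      ∀ p ∈ L, p.1.norm < 2 * n ∧ p.2.norm < 2 * n := by
  induction g generalizing Q with
  | zero =>
    rcases linked _ Q le_rfl hQ with h | ⟨A, B, C, D, F, x, y, rfl⟩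
    · exact ⟨[], rfl, by simpa using h, by simp⟩
    · obtain ⟨a, b, -, -, -, -, -, h⟩ := handle n hn A B C D F x y hQ hl
      omega
  | succ g ih =>
    rcases linked _ Q le_rfl hQ with h | ⟨A, B, C, D, F, x, y, rfl⟩
    · refine ⟨List.replicate (g + 1) (1, 1), by simp, by simp [h, cm], ?_⟩
      intro p hp
      obtain rfl := List.eq_of_mem_replicate hp
      simp; omega
    · obtain ⟨a, b, ha, hb, hm, hq, hln, h⟩ := handle n hn A B C D F x y hQ hl
      obtain ⟨L, hL, hp, hb'⟩ := ih _ hq hln (by omega)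
      refine ⟨(a, b) :: L, by simp [hL], by rw [hm, hp]; simp, ?_⟩
      intro p hp
      rcases List.mem_cons.1 hp with rfl | hp
      · exact ⟨ha, hb⟩
      · exact hb' p hp

end Stmt15

/-- Orientable genus bound, non-minimal form: if a nontrivial element `C` of a free group
is a product of `g ≥ 1` commutators (`[x,y] = x⁻¹ y⁻¹ x y`), then it is such a product
with all entries of length `< 2|C|`. -/
theorem stmt_15 {α : Type*} [DecidableEq α] (C : FreeGroup α) (hC : C ≠ 1) (g : ℕ)
    (hg : 1 ≤ g)
    (h : ∃ a b : Fin g → FreeGroup α,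
        C = (List.ofFn fun i => (a i)⁻¹ * (b i)⁻¹ * a i * b i).prod) :
    ∃ a b : Fin g → FreeGroup α,
      C = (List.ofFn fun i => (a i)⁻¹ * (b i)⁻¹ * a i * b i).prod ∧
      ∀ i, (a i).norm < 2 * C.norm ∧ (b i).norm < 2 * C.norm := by
  classical
  have hK : Stmt15.IsProd g C := by
    obtain ⟨a, b, hab⟩ := h
    refine ⟨List.ofFn fun i => (a i, b i), by simp, ?_⟩
    rw [hab, List.map_ofFn]
    rfl
  have hn : 1 ≤ C.norm := by
    rw [Nat.one_le_iff_ne_zero]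
    intro h0
    exact hC (FreeGroup.norm_eq_zero.1 h0)
  obtain ⟨E, _, _, w, hw, hrep⟩ := Stmt15.rep_exists g C hK
  have hred : FreeGroup.Red w C.toWord := by
    rw [← hw, FreeGroup.toWord_mk]
    exact FreeGroup.reduce.red
  obtain ⟨Q, φ, hQ, hQw, hQK⟩ := Stmt15.rep_red hred hrep
  have hlen : Q.length = C.norm := by
    rw [FreeGroup.norm, ← hQw, List.length_map]
  obtain ⟨L, hL, hLp, hLn⟩ := Stmt15.extract C.norm hn g Q hQ hlen.le
    (Stmt15.isProd_rank (hQK.map Stmt15.mag))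
  subst hL
  refine ⟨fun i => Stmt15.hm φ L[i].1, fun i => Stmt15.hm φ L[i].2, ?_, fun i => ?_⟩
  · have h1 : C = Stmt15.hm φ (FreeGroup.mk Q) := by
      rw [Stmt15.hm_mk, hQw, FreeGroup.mk_toWord]
    rw [h1, hLp, map_list_prod, List.map_map]
    congr 1
    apply List.ext_getElem
    · simp
    · intro i _ _
      simp [Stmt15.cm]
  · have := hLn L[i] (List.getElem_mem _)
    exact ⟨(Stmt15.norm_hm φ _).trans_lt this.1, (Stmt15.norm_hm φ _).trans_lt this.2⟩
end
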